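/- Assume the pair (Φ₁, Φ₂) is regular semisimple. Let x₁ ∈ K₁ and x₂ ∈ K₂ be F-algebra generators, set w = Φ₁(x₁)·Φ₂(x₂) + Φ₂(σ₂(x₂))·Φ₁(σ₁(x₁)) and z = Φ₁(x₁)·Φ₂(x₂) − Φ₂(x₂)·Φ₁(x₁) in B, let A ⊆ B be the F-subalgebra generated by the images Φ₁(K₁) ∪ Φ₂(K₂), and let L ⊆ B be the F-subalgebra generated by w. Then: (1) z is a unit of B; (2) L is an étale F-algebra with dim_F L = h; (3) the centralizer of A in B equals L; (4) the centralizer of L in B equals A; (5) the center of A equals L, and A is a free L-module of rank 4; (6) B is free as a left A-module. -/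

import Mathlib

open TensorProduct

set_option synthInstance.maxHeartbeats 1000000
set_option maxHeartbeats 2000000

universe u

/-- `τ₃ = σ₁ ⊗ σ₂` on `K = K₁ ⊗[F] K₂`. -/
noncomputable def tau3 {F : Type u} [Field F] {K₁ K₂ : Type u}
    [CommRing K₁] [CommRing K₂] [Algebra F K₁] [Algebra F K₂]
    (σ₁ : K₁ ≃ₐ[F] K₁) (σ₂ : K₂ ≃ₐ[F] K₂) :
    (K₁ ⊗[F] K₂) ≃ₐ[F] (K₁ ⊗[F] K₂) :=
  Algebra.TensorProduct.congr σ₁ σ₂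

/-- `K₃ ⊆ K₁ ⊗[F] K₂`, the subalgebra of `τ₃`-fixed elements. -/
noncomputable def K3 {F : Type u} [Field F] {K₁ K₂ : Type u}
    [CommRing K₁] [CommRing K₂] [Algebra F K₁] [Algebra F K₂]
    (σ₁ : K₁ ≃ₐ[F] K₁) (σ₂ : K₂ ≃ₐ[F] K₂) : Subalgebra F (K₁ ⊗[F] K₂) :=
  AlgHom.equalizer (tau3 σ₁ σ₂).toAlgHom (AlgHom.id F _)

attribute [local instance] Algebra.TensorProduct.rightAlgebra

/-- The words `1, a, b, ab` in two elements `a`, `b` of a ring. -/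
def quatWord {E : Type*} [Ring E] (a b : E) : Fin 4 → E := ![1, a, b, a * b]

lemma sum_mul_quatWord {E : Type*} [Ring E] (a b : E) (c : Fin 4 → E) :
    ∑ i, c i * quatWord a b i = c 0 + c 1 * a + c 2 * b + c 3 * (a * b) := by
  simp [Fin.sum_univ_four, quatWord]

lemma commutator_left_sum_quatWord {E : Type*} [Ring E] {a b : E} (c : Fin 4 → E)
    (ha : ∀ i, Commute (c i) a) :
    a * (∑ i, c i * quatWord a b i) - (∑ i, c i * quatWord a b i) * a =
      (c 2 + c 3 * a) * (a * b - b * a) := by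
  rw [sum_mul_quatWord]
  simp only [mul_add, add_mul, mul_sub, (ha 0).eq, (ha 1).symm.left_comm, (ha 2).symm.left_comm,
    (ha 3).symm.left_comm, mul_assoc]
  abel

/-- If `ab - ba` is invertible, then `1, a, b, ab` are independent over coefficients commuting
with `a` and `b`. -/
lemma eq_zero_of_sum_quatWord_eq_zero {E : Type*} [Ring E] {a b : E}
    (hz : IsUnit (a * b - b * a)) (c : Fin 4 → E)
    (ha : ∀ i, Commute (c i) a) (hb : ∀ i, Commute (c i) b)
    (h : ∑ i, c i * quatWord a b i = 0) : c = 0 := by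
  have key := commutator_left_sum_quatWord (b := b) c ha
  rw [h, mul_zero, zero_mul, sub_zero, eq_comm, hz.mul_left_eq_zero] at key
  have e3 : c 3 * (a * b - b * a) = 0 := by
    have : (c 2 + c 3 * a) * b - b * (c 2 + c 3 * a) = 0 := by rw [key]; simp
    rw [← this]
    simp only [mul_add, add_mul, mul_sub, (hb 2).eq, (hb 3).symm.left_comm, mul_assoc]
    abel
  rw [hz.mul_left_eq_zero] at e3
  have e2 : c 2 = 0 := by simpa [e3] using key
  rw [sum_mul_quatWord, e2, e3] at h
  have e1 : c 1 * (a * b - b * a) = 0 := by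
    have : (c 0 + c 1 * a) * b - b * (c 0 + c 1 * a) = 0 := by
      rw [show c 0 + c 1 * a = 0 by simpa using h]; simp
    rw [← this]
    simp only [mul_add, add_mul, mul_sub, (hb 0).eq, (hb 1).symm.left_comm, mul_assoc]
    abel
  rw [hz.mul_left_eq_zero] at e1
  have e0 : c 0 = 0 := by simpa [e1] using h
  ext i
  fin_cases i <;> simpa

/-- An element `∑ cᵢ mᵢ` (with `mᵢ` running over `1, a, b, ab`) commuting with `a` and `b` is its
own coefficient `c 0`. -/
lemma sum_quatWord_eq_of_commute {E : Type*} [Ring E] {a b : E}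
    (hz : IsUnit (a * b - b * a)) (c : Fin 4 → E)
    (ha : ∀ i, Commute (c i) a) (hb : ∀ i, Commute (c i) b)
    (hxa : Commute (∑ i, c i * quatWord a b i) a)
    (hxb : Commute (∑ i, c i * quatWord a b i) b) :
    ∑ i, c i * quatWord a b i = c 0 := by
  have key := commutator_left_sum_quatWord (b := b) c ha
  rw [hxa.eq, sub_self, eq_comm, hz.mul_left_eq_zero] at key
  have hd := eq_zero_of_sum_quatWord_eq_zero hz ![c 2, c 3, 0, 0]
    (by intro i; fin_cases i <;> simp [ha]) (by intro i; fin_cases i <;> simp [hb])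
    (by simpa [sum_mul_quatWord] using key)
  have e2 : c 2 = 0 := by simpa using congrFun hd 0
  have e3 : c 3 = 0 := by simpa using congrFun hd 1
  rw [sum_mul_quatWord, e2, e3] at hxb ⊢
  have e1 : c 1 * (a * b - b * a) = 0 := by
    have : (c 0 + c 1 * a) * b - b * (c 0 + c 1 * a) = 0 := by
      rw [sub_eq_zero]; simpa using hxb.eq
    rw [← this]
    simp only [mul_add, add_mul, mul_sub, (hb 0).eq, (hb 1).symm.left_comm, mul_assoc]
    abel
  rw [hz.mul_left_eq_zero] at e1
  simp [e1]

/-- Quaternion-type relations make the `S`-span of `1, a, b, ab` closed under multiplication. -/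
lemma exists_eq_sum_quatWord_of_mem_adjoin {F E : Type*} [CommRing F] [Ring E] [Algebra F E]
    (S : Subalgebra F E) {a b : E}
    (ha : ∀ s ∈ S, Commute s a) (hb : ∀ s ∈ S, Commute s b) {t₁ n₁ t₂ n₂ q : E}
    (ht₁ : t₁ ∈ S) (hn₁ : n₁ ∈ S) (ht₂ : t₂ ∈ S) (hn₂ : n₂ ∈ S) (hq : q ∈ S)
    (haa : a * a = t₁ * a - n₁) (hbb : b * b = t₂ * b - n₂)
    (hba : b * a = q + t₂ * a + t₁ * b - a * b) {x : E} (hx : x ∈ Algebra.adjoin F {a, b}) :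
    ∃ c : Fin 4 → E, (∀ i, c i ∈ S) ∧ x = ∑ i, c i * quatWord a b i := by
  let P : E → Prop := fun x ↦ ∃ c : Fin 4 → E, (∀ i, c i ∈ S) ∧ x = ∑ i, c i * quatWord a b i
  have hP (c0 c1 c2 c3 : E) (h0 : c0 ∈ S) (h1 : c1 ∈ S) (h2 : c2 ∈ S) (h3 : c3 ∈ S) (x : E)
      (h : x = c0 + c1 * a + c2 * b + c3 * (a * b)) : P x :=
    ⟨![c0, c1, c2, c3], by intro i; fin_cases i <;> simpa, by simpa [sum_mul_quatWord] using h⟩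
  have hmul : ∀ y, P y → P (x * y) := by
    induction hx using Algebra.adjoin_induction with
    | mem x hx =>
      rintro y ⟨c, hc, rfl⟩
      rw [sum_mul_quatWord]
      have at2 := (ha _ ht₂).eq
      rcases hx with rfl | rfl
      · refine hP (-(c 1 * n₁)) (c 0 + c 1 * t₁) (-(c 3 * n₁)) (c 2 + c 3 * t₁) ?_ ?_ ?_ ?_ _ ?_
        · exact neg_mem (mul_mem (hc 1) hn₁)
        · exact add_mem (hc 0) (mul_mem (hc 1) ht₁)
        · exact neg_mem (mul_mem (hc 3) hn₁)
        · exact add_mem (hc 2) (mul_mem (hc 3) ht₁)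
        · have hab : x * (x * b) = t₁ * (x * b) - n₁ * b := by
            rw [← mul_assoc, haa, sub_mul, mul_assoc]
          calc x * (c 0 + c 1 * x + c 2 * b + c 3 * (x * b))
              = c 0 * x + c 1 * (x * x) + c 2 * (x * b) + c 3 * (x * (x * b)) := by
                rw [mul_add, mul_add, mul_add, (ha _ (hc 0)).eq, (ha _ (hc 1)).symm.left_comm,
                  (ha _ (hc 2)).symm.left_comm, (ha _ (hc 3)).symm.left_comm]
            _ = _ := by rw [haa, hab]; noncomm_ring
      · have hbab : x * (a * x) = q * x + t₁ * (t₂ * x - n₂) + n₂ * a := by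
          rw [← mul_assoc, hba]
          have h1 : a * x * x = t₂ * (a * x) - n₂ * a := by
            rw [mul_assoc, hbb, mul_sub, ← mul_assoc, ← at2, (ha _ hn₂).eq, mul_assoc]
          rw [sub_mul, add_mul, add_mul, h1, mul_assoc t₁, hbb]
          noncomm_ring
        refine hP (c 1 * q - c 2 * n₂ - c 3 * (t₁ * n₂)) (c 1 * t₂ + c 3 * n₂)
          (c 0 + c 1 * t₁ + c 2 * t₂ + c 3 * (q + t₁ * t₂)) (-c 1) ?_ ?_ ?_ ?_ _ ?_
        · exact sub_mem (sub_mem (mul_mem (hc 1) hq) (mul_mem (hc 2) hn₂))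
            (mul_mem (hc 3) (mul_mem ht₁ hn₂))
        · exact add_mem (mul_mem (hc 1) ht₂) (mul_mem (hc 3) hn₂)
        · exact add_mem (add_mem (add_mem (hc 0) (mul_mem (hc 1) ht₁)) (mul_mem (hc 2) ht₂))
            (mul_mem (hc 3) (add_mem hq (mul_mem ht₁ ht₂)))
        · exact neg_mem (hc 1)
        · calc x * (c 0 + c 1 * a + c 2 * x + c 3 * (a * x))
              = c 0 * x + c 1 * (x * a) + c 2 * (x * x) + c 3 * (x * (a * x)) := by
                rw [mul_add, mul_add, mul_add, (hb _ (hc 0)).eq, (hb _ (hc 1)).symm.left_comm,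
                  (hb _ (hc 2)).symm.left_comm, (hb _ (hc 3)).symm.left_comm]
            _ = _ := by rw [hba, hbb, hbab]; noncomm_ring
    | algebraMap r =>
      rintro y ⟨c, hc, rfl⟩
      exact ⟨fun i ↦ algebraMap F E r * c i, fun i ↦ mul_mem (S.algebraMap_mem r) (hc i),
        by simp [Finset.mul_sum, mul_assoc]⟩
    | add x y _ _ hx hy =>
      intro v hv
      obtain ⟨c, hc, h1⟩ := hx v hv
      obtain ⟨d, hd, h2⟩ := hy v hv
      exact ⟨fun i ↦ c i + d i, fun i ↦ add_mem (hc i) (hd i),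
        by rw [add_mul, h1, h2]; simp [add_mul, Finset.sum_add_distrib]⟩
    | mul x y _ _ hx hy =>
      intro v hv
      rw [mul_assoc]
      exact hx _ (hy _ hv)
  have h1 : P 1 := hP 1 0 0 0 (one_mem _) (zero_mem _) (zero_mem _) (zero_mem _) 1 (by simp)
  simpa using hmul 1 h1

lemma map_quatWord {E E' : Type*} [Ring E] [Ring E'] (f : E →+* E') (a b : E) (i : Fin 4) :
    f (quatWord a b i) = quatWord (f a) (f b) i := by
  fin_cases i <;> simp [quatWord]

lemma isUnit_of_forall_mul_eq_zero (F : Type*) {D : Type*} [Field F] [Ring D] [Algebra F D]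
    [FiniteDimensional F D] {z : D} (h : ∀ x, z * x = 0 → x = 0) : IsUnit z := by
  have : IsArtinianRing Dᵐᵒᵖ := IsArtinianRing.of_finite F _
  rw [IsArtinianRing.isUnit_iff_isLeftRegular]
  intro x y hxy
  exact sub_eq_zero.mp (h _ (by rw [mul_sub]; exact sub_eq_zero.mpr hxy))

lemma isUnit_sub_conj {F K : Type*} [Field F] [CommRing K] [Algebra F K] [Algebra.Etale F K]
    (hdim : Module.finrank F K = 2) (σ : K ≃ₐ[F] K) (hσ : ∀ x, σ (σ x) = x)
    (hfix : ∀ x : K, σ x = x ↔ ∃ a : F, algebraMap F K a = x) {x : K}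
    (hx : ∀ k : K, ∃ a b : F, k = algebraMap F K a + algebraMap F K b * x) :
    IsUnit (x - σ x) := by
  have : IsReduced K := Algebra.FormallyUnramified.isReduced_of_field F K
  obtain ⟨d, hd⟩ := (hfix ((x - σ x) ^ 2)).mp (by simp only [map_pow, map_sub, hσ]; ring)
  have hd0 : d ≠ 0 := by
    rintro rfl
    have h0 : x - σ x = 0 := by
      have : (x - σ x) ^ 2 = 0 := by rw [← hd, map_zero]
      exact pow_eq_zero_iff two_ne_zero |>.mp this
    obtain ⟨a, ha⟩ := (hfix x).mp (sub_eq_zero.mp h0).symm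
    have hle : Module.finrank F K ≤ 1 := by
      refine finrank_le_one (1 : K) fun k ↦ ?_
      obtain ⟨c, e, rfl⟩ := hx k
      exact ⟨c + e * a, by rw [Algebra.smul_def, mul_one, map_add, map_mul, ha]⟩
    omega
  have : IsUnit ((x - σ x) ^ 2) := by rw [← hd]; exact (IsUnit.mk0 d hd0).map _
  exact (isUnit_pow_iff two_ne_zero).mp this

section QuaternionRelations

variable {R E : Type*} [CommRing R] [Ring E] [Algebra R E] {a b : E} {t₁ n₁ t₂ n₂ : R}

lemma commute_left_of_quaternion_relations (haa : a * a = t₁ • a - n₁ • 1) :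
    Commute (a * b + b * a - t₁ • b - t₂ • a + (t₁ * t₂) • 1) a := by
  have haa' (x : E) : a * (a * x) = t₁ • (a * x) - n₁ • x := by
    rw [← mul_assoc, haa]; simp [sub_mul]
  rw [Commute, SemiconjBy]
  simp only [add_mul, sub_mul, mul_add, mul_sub, smul_mul_assoc, mul_smul_comm, mul_assoc, haa,
    haa', one_mul, mul_one]
  module

lemma commute_right_of_quaternion_relations (hbb : b * b = t₂ • b - n₂ • 1) :
    Commute (a * b + b * a - t₁ • b - t₂ • a + (t₁ * t₂) • 1) b := by
  have hbb' (x : E) : b * (b * x) = t₂ • (b * x) - n₂ • x := by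
    rw [← mul_assoc, hbb]; simp [sub_mul]
  rw [Commute, SemiconjBy]
  simp only [add_mul, sub_mul, mul_add, mul_sub, smul_mul_assoc, mul_smul_comm, mul_assoc, hbb,
    hbb', one_mul, mul_one]
  module

lemma commutator_sq_of_quaternion_relations (haa : a * a = t₁ • a - n₁ • 1)
    (hbb : b * b = t₂ • b - n₂ • 1) {w : E}
    (hw : w = a * b + b * a - t₁ • b - t₂ • a + (t₁ * t₂) • 1) :
    (a * b - b * a) * (a * b - b * a) =
      w * w - (t₁ * t₂) • w + (n₁ * t₂ ^ 2 + n₂ * t₁ ^ 2 - 4 * n₁ * n₂) • 1 := by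
  have haa' (x : E) : a * (a * x) = t₁ • (a * x) - n₁ • x := by
    rw [← mul_assoc, haa]; simp [sub_mul]
  have hbb' (x : E) : b * (b * x) = t₂ • (b * x) - n₂ • x := by
    rw [← mul_assoc, hbb]; simp [sub_mul]
  subst hw
  simp only [add_mul, sub_mul, mul_add, mul_sub, smul_mul_assoc, mul_smul_comm, mul_assoc, haa,
    haa', hbb, hbb', one_mul, mul_one, smul_add, smul_sub]
  module

lemma sq_linear_of_quaternion_relations (haa : a * a = t₁ • a - n₁ • 1)
    (hbb : b * b = t₂ • b - n₂ • 1) {w : E}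
    (hw : w = a * b + b * a - t₁ • b - t₂ • a + (t₁ * t₂) • 1) {p q₁ q₂ w₀ : R}
    (h₁ : 2 * p * q₁ + q₁ ^ 2 * t₁ = q₁ * q₂ * t₂) (h₂ : -2 * p * q₂ + q₂ ^ 2 * t₂ = q₁ * q₂ * t₁)
    (h₃ : p ^ 2 - q₁ ^ 2 * n₁ - q₂ ^ 2 * n₂ = -(q₁ * q₂) * (t₁ * t₂ - w₀)) :
    (p • 1 + q₁ • a - q₂ • b) ^ 2 = (-(q₁ * q₂)) • (w - w₀ • 1) := by
  subst hw
  rw [sq]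
  simp only [add_mul, sub_mul, mul_add, mul_sub, smul_mul_assoc, mul_smul_comm, haa,
    hbb, one_mul, mul_one, smul_add, smul_sub]
  linear_combination (norm := module) h₁ • a + h₂ • b + h₃ • (1 : E)

end QuaternionRelations

section RegularPair

variable {F K₁ K₂ : Type u} [Field F] [CommRing K₁] [CommRing K₂] [Algebra F K₁] [Algebra F K₂]
  {σ₁ : K₁ ≃ₐ[F] K₁} {σ₂ : K₂ ≃ₐ[F] K₂}

lemma mem_K3 {k : K₁ ⊗[F] K₂} : k ∈ K3 σ₁ σ₂ ↔ tau3 σ₁ σ₂ k = k := Iff.rfl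

@[simp] lemma tau3_tmul (x : K₁) (y : K₂) :
    tau3 σ₁ σ₂ (x ⊗ₜ y) = σ₁ x ⊗ₜ σ₂ y := rfl

lemma tau3_tau3 (hσ₁ : ∀ x, σ₁ (σ₁ x) = x) (hσ₂ : ∀ x, σ₂ (σ₂ x) = x) (k : K₁ ⊗[F] K₂) :
    tau3 σ₁ σ₂ (tau3 σ₁ σ₂ k) = k := by
  induction k with
  | zero => simp
  | add x y hx hy => rw [map_add, map_add, hx, hy]
  | tmul x y => simp [hσ₁, hσ₂]

/-- The involution of `K₃` induced by `σ₁ ⊗ 1`. -/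
noncomputable def K3swap (σ₁ : K₁ ≃ₐ[F] K₁) (σ₂ : K₂ ≃ₐ[F] K₂) : K3 σ₁ σ₂ →ₐ[F] K3 σ₁ σ₂ :=
  ((Algebra.TensorProduct.map (σ₁ : K₁ →ₐ[F] K₁) (AlgHom.id F K₂)).comp (K3 σ₁ σ₂).val).codRestrict
    (K3 σ₁ σ₂) fun k ↦ by
      obtain ⟨k, hk⟩ := k
      rw [mem_K3] at hk ⊢
      have : ∀ k, tau3 σ₁ σ₂ (Algebra.TensorProduct.map (σ₁ : K₁ →ₐ[F] K₁) (AlgHom.id F K₂) k) =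
          Algebra.TensorProduct.map (σ₁ : K₁ →ₐ[F] K₁) (AlgHom.id F K₂) (tau3 σ₁ σ₂ k) := fun k ↦ by
        induction k with
        | zero => simp
        | add x y hx hy => simp only [map_add, hx, hy]
        | tmul x y => simp
      change tau3 σ₁ σ₂ (Algebra.TensorProduct.map (σ₁ : K₁ →ₐ[F] K₁) (AlgHom.id F K₂) k) =
        Algebra.TensorProduct.map (σ₁ : K₁ →ₐ[F] K₁) (AlgHom.id F K₂) k
      rw [this, hk]

/-- The element `σ₁ x₁ ⊗ x₂ + x₁ ⊗ σ₂ x₂` of `K₃`. -/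
noncomputable def K3trace (hσ₁ : ∀ x, σ₁ (σ₁ x) = x) (hσ₂ : ∀ x, σ₂ (σ₂ x) = x)
    (x₁ : K₁) (x₂ : K₂) : K3 σ₁ σ₂ :=
  ⟨σ₁ x₁ ⊗ₜ x₂ + x₁ ⊗ₜ σ₂ x₂, by
    rw [mem_K3]; simp [hσ₁, hσ₂, add_comm]⟩

lemma K3swap_K3trace (hσ₁ : ∀ x, σ₁ (σ₁ x) = x) (hσ₂ : ∀ x, σ₂ (σ₂ x) = x)
    (x₁ : K₁) (x₂ : K₂) :
    (K3swap σ₁ σ₂ (K3trace hσ₁ hσ₂ x₁ x₂) : K₁ ⊗[F] K₂) = x₁ ⊗ₜ x₂ + σ₁ x₁ ⊗ₜ σ₂ x₂ := by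
  change Algebra.TensorProduct.map (σ₁ : K₁ →ₐ[F] K₁) (AlgHom.id F K₂)
    (σ₁ x₁ ⊗ₜ x₂ + x₁ ⊗ₜ σ₂ x₂) = _
  simp [hσ₁]

variable {B : Type u} [Ring B] [Algebra F B]

lemma mul_self_image {K : Type*} [CommRing K] [Algebra F K] (Φ : K →ₐ[F] B) {x x' : K} {t n : F}
    (ht : algebraMap F K t = x + x') (hn : algebraMap F K n = x * x') :
    Φ x * Φ x = t • Φ x - n • 1 := by
  rw [Algebra.smul_def, Algebra.smul_def, mul_one, ← Φ.commutes, ← Φ.commutes, ht, hn, ← map_mul,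
    ← map_mul, ← map_sub]
  congr 1
  ring

lemma pair_trace_eq {K K' : Type*} [CommRing K] [CommRing K'] [Algebra F K] [Algebra F K']
    (Φ : K →ₐ[F] B) (Φ' : K' →ₐ[F] B) {x x' : K} {y y' : K'} {t t' : F}
    (ht : algebraMap F K t = x + x') (ht' : algebraMap F K' t' = y + y') :
    Φ x * Φ' y + Φ' y' * Φ x' =
      Φ x * Φ' y + Φ' y * Φ x - t • Φ' y - t' • Φ x + (t * t') • 1 := by
  have e : Φ x' = t • 1 - Φ x := by
    rw [Algebra.smul_def, mul_one, ← Φ.commutes, ht, map_add]; abel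
  have e' : Φ' y' = t' • 1 - Φ' y := by
    rw [Algebra.smul_def, mul_one, ← Φ'.commutes, ht', map_add]; abel
  rw [e, e']
  simp only [mul_sub, sub_mul, smul_mul_assoc, mul_smul_comm, one_mul, mul_one]
  module

/-- The invariant `s` of a pair differs from `w ⊗ 1 - 1 ⊗ w₀` by a unit of `K₃`. -/
lemma exists_invariant_eq (hσ₁ : ∀ x, σ₁ (σ₁ x) = x) (hσ₂ : ∀ x, σ₂ (σ₂ x) = x)
    {x₁ : K₁} {x₂ : K₂} (hδ₁ : IsUnit (x₁ - σ₁ x₁)) (hδ₂ : IsUnit (x₂ - σ₂ x₂))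
    {t₁ n₁ t₂ n₂ : F} (ht₁ : algebraMap F K₁ t₁ = x₁ + σ₁ x₁) (hn₁ : algebraMap F K₁ n₁ = x₁ * σ₁ x₁)
    (ht₂ : algebraMap F K₂ t₂ = x₂ + σ₂ x₂) (hn₂ : algebraMap F K₂ n₂ = x₂ * σ₂ x₂)
    {Φ₁ : K₁ →ₐ[F] B} {Φ₂ : K₂ →ₐ[F] B}
    {Φt₁ Φt₂ : (K₁ ⊗[F] K₂) →ₐ[F] B ⊗[F] (K3 σ₁ σ₂)}
    (hΦt₁ : ∀ x : K₁, Φt₁ (x ⊗ₜ[F] (1 : K₂)) = Φ₁ x ⊗ₜ[F] (1 : K3 σ₁ σ₂))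
    (hΦt₂ : ∀ x : K₂, Φt₂ ((1 : K₁) ⊗ₜ[F] x) = Φ₂ x ⊗ₜ[F] (1 : K3 σ₁ σ₂))
    (hΦt₁c : ∀ c : K3 σ₁ σ₂, Φt₁ (c : K₁ ⊗[F] K₂) = (1 : B) ⊗ₜ[F] c)
    (hΦt₂c : ∀ c : K3 σ₁ σ₂, Φt₂ (c : K₁ ⊗[F] K₂) = (1 : B) ⊗ₜ[F] c)
    {y : K₁ ⊗[F] K₂} (hy : IsUnit (y - tau3 σ₁ σ₂ y)) :
    ∃ κ : (K3 σ₁ σ₂)ˣ,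
      Ring.inverse (Φt₁ ((y - tau3 σ₁ σ₂ y) ^ 2)) * (Φt₁ y - Φt₂ (tau3 σ₁ σ₂ y)) ^ 2 =
        (κ : K3 σ₁ σ₂) • ((Φ₁ x₁ * Φ₂ x₂ + Φ₂ (σ₂ x₂) * Φ₁ (σ₁ x₁)) ⊗ₜ[F] (1 : K3 σ₁ σ₂) -
          K3trace hσ₁ hσ₂ x₁ x₂ • 1) := by
  obtain ⟨d₁, hd₁⟩ := hδ₁.exists_right_inv
  obtain ⟨d₂, hd₂⟩ := hδ₂.exists_right_inv
  have hd₁' : σ₁ d₁ = -d₁ := by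
    have h := congrArg σ₁ hd₁
    simp only [map_mul, map_sub, hσ₁, map_one] at h
    linear_combination (-d₁) * h - σ₁ d₁ * hd₁
  have hd₂' : σ₂ d₂ = -d₂ := by
    have h := congrArg σ₂ hd₂
    simp only [map_mul, map_sub, hσ₂, map_one] at h
    linear_combination (-d₂) * h - σ₂ d₂ * hd₂
  have hττ := tau3_tau3 (F := F) hσ₁ hσ₂ y
  set τ := tau3 σ₁ σ₂ with hτ
  set i₁ : K₁ →ₐ[F] K₁ ⊗[F] K₂ := Algebra.TensorProduct.includeLeft with hi₁
  set i₂ : K₂ →ₐ[F] K₁ ⊗[F] K₂ := Algebra.TensorProduct.includeRight with hi₂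
  have hτ₁ (x) : τ (i₁ x) = i₁ (σ₁ x) := by simp [hτ, hi₁]
  have hτ₂ (x) : τ (i₂ x) = i₂ (σ₂ x) := by simp [hτ, hi₂]
  have e₁ : (i₁ x₁ - i₁ (σ₁ x₁)) * i₁ d₁ = 1 := by rw [← map_sub, ← map_mul, hd₁, map_one]
  have e₂ : (i₂ x₂ - i₂ (σ₂ x₂)) * i₂ d₂ = 1 := by rw [← map_sub, ← map_mul, hd₂, map_one]
  let q₁ : K3 σ₁ σ₂ := ⟨(y - τ y) * i₁ d₁, by
    rw [mem_K3, ← hτ, map_mul, map_sub, hττ, hτ₁, hd₁', map_neg]; ring⟩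
  let q₂ : K3 σ₁ σ₂ := ⟨(τ y - y) * i₂ d₂, by
    rw [mem_K3, ← hτ, map_mul, map_sub, hττ, hτ₂, hd₂', map_neg]; ring⟩
  let p₁ : K3 σ₁ σ₂ := ⟨y - (y - τ y) * i₁ d₁ * i₁ x₁, by
    rw [mem_K3, ← hτ, map_sub, map_mul, map_mul, map_sub, hττ, hτ₁, hτ₁, hd₁', map_neg]
    linear_combination (y - τ y) * e₁⟩
  let p₂ : K3 σ₁ σ₂ := ⟨τ y - (τ y - y) * i₂ d₂ * i₂ x₂, by
    rw [mem_K3, ← hτ, map_sub, map_mul, map_mul, map_sub, hττ, hτ₂, hτ₂, hd₂', map_neg]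
    linear_combination (τ y - y) * e₂⟩
  let κ : (K3 σ₁ σ₂)ˣ :=
    { val := ⟨i₁ d₁ * i₂ d₂, by rw [mem_K3, ← hτ, map_mul, hτ₁, hτ₂, hd₁', hd₂']; simp⟩
      inv := ⟨(i₁ x₁ - i₁ (σ₁ x₁)) * (i₂ x₂ - i₂ (σ₂ x₂)), by
        rw [mem_K3, ← hτ, map_mul, map_sub, map_sub, hτ₁, hτ₂, hτ₁, hτ₂, hσ₁, hσ₂]; ring⟩
      val_inv := Subtype.ext <| by
        change i₁ d₁ * i₂ d₂ * ((i₁ x₁ - i₁ (σ₁ x₁)) * (i₂ x₂ - i₂ (σ₂ x₂))) = 1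
        linear_combination (i₂ x₂ - i₂ (σ₂ x₂)) * i₂ d₂ * e₁ + e₂
      inv_val := Subtype.ext <| by
        change (i₁ x₁ - i₁ (σ₁ x₁)) * (i₂ x₂ - i₂ (σ₂ x₂)) * (i₁ d₁ * i₂ d₂) = 1
        linear_combination (i₂ x₂ - i₂ (σ₂ x₂)) * i₂ d₂ * e₁ + e₂ }
  let D2 : K3 σ₁ σ₂ := ⟨(y - τ y) ^ 2, by rw [mem_K3, ← hτ, map_pow, map_sub, hττ]; ring⟩
  have hsmul (c : K3 σ₁ σ₂) (x : B ⊗[F] K3 σ₁ σ₂) : c • x = ((1 : B) ⊗ₜ[F] c) * x :=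
    Algebra.smul_def c x
  refine ⟨κ, ?_⟩
  have hu : IsUnit (Φt₁ ((y - τ y) ^ 2)) := (hy.pow 2).map Φt₁
  rw [Ring.inverse_mul_eq_iff_eq_mul _ _ _ hu]
  have hT₁ : Φt₁ y = p₁ • (1 : B ⊗[F] K3 σ₁ σ₂) + q₁ • (Φ₁ x₁ ⊗ₜ 1) := by
    rw [hsmul, hsmul, mul_one, ← hΦt₁c, ← hΦt₁c, ← hΦt₁, ← map_mul, ← map_add]
    congr 1
    change y = y - (y - τ y) * i₁ d₁ * i₁ x₁ + (y - τ y) * i₁ d₁ * i₁ x₁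
    ring
  have hT₂ : Φt₂ (τ y) = p₂ • (1 : B ⊗[F] K3 σ₁ σ₂) + q₂ • (Φ₂ x₂ ⊗ₜ 1) := by
    rw [hsmul, hsmul, mul_one, ← hΦt₂c, ← hΦt₂c, ← hΦt₂, ← map_mul, ← map_add]
    congr 1
    change τ y = τ y - (τ y - y) * i₂ d₂ * i₂ x₂ + (τ y - y) * i₂ d₂ * i₂ x₂
    ring
  have hD : Φt₁ ((y - τ y) ^ 2) = (1 : B) ⊗ₜ[F] D2 := hΦt₁c D2
  have hF (r : F) (x : B) : (algebraMap F (K3 σ₁ σ₂) r) • (x ⊗ₜ[F] (1 : K3 σ₁ σ₂)) =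
      (r • x) ⊗ₜ[F] (1 : K3 σ₁ σ₂) := by
    rw [hsmul, Algebra.TensorProduct.tmul_mul_tmul, one_mul, mul_one,
      Algebra.algebraMap_eq_smul_one, TensorProduct.tmul_smul, TensorProduct.smul_tmul']
  have haa : (Φ₁ x₁ ⊗ₜ[F] (1 : K3 σ₁ σ₂)) * (Φ₁ x₁ ⊗ₜ[F] (1 : K3 σ₁ σ₂)) =
      algebraMap F (K3 σ₁ σ₂) t₁ • (Φ₁ x₁ ⊗ₜ[F] (1 : K3 σ₁ σ₂)) -
        algebraMap F (K3 σ₁ σ₂) n₁ • 1 := by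
    rw [Algebra.TensorProduct.one_def, hF, hF, Algebra.TensorProduct.tmul_mul_tmul, mul_one,
      ← TensorProduct.sub_tmul, mul_self_image Φ₁ ht₁ hn₁]
  have hbb : (Φ₂ x₂ ⊗ₜ[F] (1 : K3 σ₁ σ₂)) * (Φ₂ x₂ ⊗ₜ[F] (1 : K3 σ₁ σ₂)) =
      algebraMap F (K3 σ₁ σ₂) t₂ • (Φ₂ x₂ ⊗ₜ[F] (1 : K3 σ₁ σ₂)) -
        algebraMap F (K3 σ₁ σ₂) n₂ • 1 := by
    rw [Algebra.TensorProduct.one_def, hF, hF, Algebra.TensorProduct.tmul_mul_tmul, mul_one,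
      ← TensorProduct.sub_tmul, mul_self_image Φ₂ ht₂ hn₂]
  have hw : (Φ₁ x₁ * Φ₂ x₂ + Φ₂ (σ₂ x₂) * Φ₁ (σ₁ x₁)) ⊗ₜ[F] (1 : K3 σ₁ σ₂) =
      (Φ₁ x₁ ⊗ₜ[F] (1 : K3 σ₁ σ₂)) * (Φ₂ x₂ ⊗ₜ[F] (1 : K3 σ₁ σ₂)) +
      (Φ₂ x₂ ⊗ₜ[F] (1 : K3 σ₁ σ₂)) * (Φ₁ x₁ ⊗ₜ[F] (1 : K3 σ₁ σ₂)) -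
      algebraMap F (K3 σ₁ σ₂) t₁ • (Φ₂ x₂ ⊗ₜ[F] (1 : K3 σ₁ σ₂)) -
      algebraMap F (K3 σ₁ σ₂) t₂ • (Φ₁ x₁ ⊗ₜ[F] (1 : K3 σ₁ σ₂)) +
      (algebraMap F (K3 σ₁ σ₂) t₁ * algebraMap F (K3 σ₁ σ₂) t₂) • 1 := by
    rw [Algebra.TensorProduct.one_def, ← map_mul, hF, hF, hF,
      Algebra.TensorProduct.tmul_mul_tmul, Algebra.TensorProduct.tmul_mul_tmul, mul_one,
      ← TensorProduct.add_tmul, ← TensorProduct.sub_tmul, ← TensorProduct.sub_tmul,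
      ← TensorProduct.add_tmul, pair_trace_eq Φ₁ Φ₂ ht₁ ht₂]
  have hK (r : F) : ((algebraMap F (K3 σ₁ σ₂) r : K3 σ₁ σ₂) : K₁ ⊗[F] K₂) = algebraMap F _ r := rfl
  have h2 : ((2 : K3 σ₁ σ₂) : K₁ ⊗[F] K₂) = 2 := rfl
  have T₁ : algebraMap F (K₁ ⊗[F] K₂) t₁ = i₁ x₁ + i₁ (σ₁ x₁) := by
    rw [← map_add, ← ht₁, i₁.commutes]
  have N₁ : algebraMap F (K₁ ⊗[F] K₂) n₁ = i₁ x₁ * i₁ (σ₁ x₁) := by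
    rw [← map_mul, ← hn₁, i₁.commutes]
  have T₂ : algebraMap F (K₁ ⊗[F] K₂) t₂ = i₂ x₂ + i₂ (σ₂ x₂) := by
    rw [← map_add, ← ht₂, i₂.commutes]
  have N₂ : algebraMap F (K₁ ⊗[F] K₂) n₂ = i₂ x₂ * i₂ (σ₂ x₂) := by
    rw [← map_mul, ← hn₂, i₂.commutes]
  have W₀ : (K3trace hσ₁ hσ₂ x₁ x₂ : K₁ ⊗[F] K₂) =
      i₁ (σ₁ x₁) * i₂ x₂ + i₁ x₁ * i₂ (σ₂ x₂) := by
    simp [K3trace, hi₁, hi₂]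
  have q₁c : (q₁ : K₁ ⊗[F] K₂) = (y - τ y) * i₁ d₁ := rfl
  have q₂c : (q₂ : K₁ ⊗[F] K₂) = (τ y - y) * i₂ d₂ := rfl
  have p₁c : (p₁ : K₁ ⊗[F] K₂) = y - (y - τ y) * i₁ d₁ * i₁ x₁ := rfl
  have p₂c : (p₂ : K₁ ⊗[F] K₂) = τ y - (τ y - y) * i₂ d₂ * i₂ x₂ := rfl
  have r₁ : (p₁ - p₂ + q₁ * i₁ x₁ : K₁ ⊗[F] K₂) = q₂ * i₂ (σ₂ x₂) := by
    rw [q₁c, q₂c, p₁c, p₂c]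
    linear_combination (y - τ y) * (-1) * e₂
  have r₂ : (p₁ - p₂ + q₁ * i₁ (σ₁ x₁) : K₁ ⊗[F] K₂) = q₂ * i₂ x₂ := by
    rw [q₁c, q₂c, p₁c, p₂c]
    linear_combination (τ y - y) * e₁
  have key := sq_linear_of_quaternion_relations haa hbb hw (p := p₁ - p₂) (q₁ := q₁) (q₂ := q₂)
    (w₀ := K3trace hσ₁ hσ₂ x₁ x₂)
    (Subtype.ext <| by
      simp only [Subalgebra.coe_add, Subalgebra.coe_mul, Subalgebra.coe_sub, Subalgebra.coe_pow,
        h2, hK, T₁, T₂]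
      linear_combination q₁ * r₁ + q₁ * r₂)
    (Subtype.ext <| by
      simp only [Subalgebra.coe_add, Subalgebra.coe_mul, Subalgebra.coe_sub, Subalgebra.coe_pow,
        Subalgebra.coe_neg, h2, hK, T₁, T₂]
      linear_combination (-q₂) * r₁ - q₂ * r₂)
    (Subtype.ext <| by
      simp only [Subalgebra.coe_mul, Subalgebra.coe_sub, Subalgebra.coe_pow, Subalgebra.coe_neg,
        hK, T₁, T₂, N₁, N₂, W₀]
      linear_combination ((p₁ : K₁ ⊗[F] K₂) - p₂) * r₂ + (q₂ * i₂ x₂ - q₁ * i₁ (σ₁ x₁)) * r₁)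
  rw [hT₁, hT₂, hD]
  rw [show p₁ • (1 : B ⊗[F] K3 σ₁ σ₂) + q₁ • (Φ₁ x₁ ⊗ₜ[F] 1) - (p₂ • 1 + q₂ • (Φ₂ x₂ ⊗ₜ[F] 1)) =
    (p₁ - p₂) • 1 + q₁ • (Φ₁ x₁ ⊗ₜ[F] 1) - q₂ • (Φ₂ x₂ ⊗ₜ[F] 1) by
      simp only [hsmul, TensorProduct.tmul_sub, sub_mul]; abel, key,
    ← hsmul, smul_smul]
  congr 1
  refine Subtype.ext ?_
  change -((y - τ y) * i₁ d₁ * ((τ y - y) * i₂ d₂)) = (y - τ y) ^ 2 * (i₁ d₁ * i₂ d₂)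
  ring

lemma isUnit_commutator_of_isUnit [FiniteDimensional F B] [Nontrivial (K₁ ⊗[F] K₂)]
    (hσ₁ : ∀ x, σ₁ (σ₁ x) = x) (hσ₂ : ∀ x, σ₂ (σ₂ x) = x) {x₁ : K₁} {x₂ : K₂}
    {t₁ n₁ t₂ n₂ : F} (ht₁ : algebraMap F K₁ t₁ = x₁ + σ₁ x₁) (hn₁ : algebraMap F K₁ n₁ = x₁ * σ₁ x₁)
    (ht₂ : algebraMap F K₂ t₂ = x₂ + σ₂ x₂) (hn₂ : algebraMap F K₂ n₂ = x₂ * σ₂ x₂)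
    (Φ₁ : K₁ →ₐ[F] B) (Φ₂ : K₂ →ₐ[F] B)
    (hu : IsUnit ((Φ₁ x₁ * Φ₂ x₂ + Φ₂ (σ₂ x₂) * Φ₁ (σ₁ x₁)) ⊗ₜ[F] (1 : K3 σ₁ σ₂) -
      K3trace hσ₁ hσ₂ x₁ x₂ • 1)) :
    IsUnit (Φ₁ x₁ * Φ₂ x₂ - Φ₂ x₂ * Φ₁ x₁) := by
  have : Nontrivial (K3 σ₁ σ₂) := (K3 σ₁ σ₂).toSubring.nontrivial
  set w := Φ₁ x₁ * Φ₂ x₂ + Φ₂ (σ₂ x₂) * Φ₁ (σ₁ x₁) with hw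
  set w₀ := K3trace hσ₁ hσ₂ x₁ x₂ with hw₀
  set z := Φ₁ x₁ * Φ₂ x₂ - Φ₂ x₂ * Φ₁ x₁ with hz
  have hsmul (c : K3 σ₁ σ₂) (x : B ⊗[F] K3 σ₁ σ₂) : c • x = ((1 : B) ⊗ₜ[F] c) * x :=
    Algebra.smul_def c x
  rw [hsmul, mul_one] at hu
  have hu' := hu.map (Algebra.TensorProduct.map (AlgHom.id F B) (K3swap σ₁ σ₂))
  rw [map_sub, Algebra.TensorProduct.map_tmul, Algebra.TensorProduct.map_tmul, map_one, map_one,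
    AlgHom.id_apply] at hu'
  have hzz := commutator_sq_of_quaternion_relations (mul_self_image Φ₁ ht₁ hn₁)
    (mul_self_image Φ₂ ht₂ hn₂) (pair_trace_eq Φ₁ Φ₂ ht₁ ht₂)
  rw [← hw, ← hz] at hzz
  have htmul (x : K₁) (y : K₂) : x ⊗ₜ[F] y = (x ⊗ₜ[F] (1 : K₂)) * ((1 : K₁) ⊗ₜ[F] y) := by simp
  have T₁ : algebraMap F (K₁ ⊗[F] K₂) t₁ = x₁ ⊗ₜ 1 + σ₁ x₁ ⊗ₜ 1 := by
    rw [← TensorProduct.add_tmul, ← ht₁]; rfl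
  have N₁ : algebraMap F (K₁ ⊗[F] K₂) n₁ = (x₁ ⊗ₜ 1) * (σ₁ x₁ ⊗ₜ 1) := by
    rw [Algebra.TensorProduct.tmul_mul_tmul, one_mul, ← hn₁]; rfl
  have T₂ : algebraMap F (K₁ ⊗[F] K₂) t₂ = 1 ⊗ₜ x₂ + 1 ⊗ₜ σ₂ x₂ := by
    rw [← TensorProduct.tmul_add, ← ht₂, ← Algebra.TensorProduct.algebraMap_apply']
  have N₂ : algebraMap F (K₁ ⊗[F] K₂) n₂ = (1 ⊗ₜ x₂) * (1 ⊗ₜ σ₂ x₂) := by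
    rw [Algebra.TensorProduct.tmul_mul_tmul, one_mul, ← hn₂,
      ← Algebra.TensorProduct.algebraMap_apply']
  have e₁ : w₀ + K3swap σ₁ σ₂ w₀ = algebraMap F _ (t₁ * t₂) := by
    refine Subtype.ext ?_
    rw [Subalgebra.coe_add, hw₀, K3swap_K3trace]
    change σ₁ x₁ ⊗ₜ x₂ + x₁ ⊗ₜ σ₂ x₂ + _ = algebraMap F (K₁ ⊗[F] K₂) (t₁ * t₂)
    rw [map_mul, T₁, T₂, htmul (σ₁ x₁) x₂, htmul x₁ (σ₂ x₂), htmul x₁ x₂, htmul (σ₁ x₁) (σ₂ x₂)]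
    ring
  have e₂ : w₀ * K3swap σ₁ σ₂ w₀ = algebraMap F _ (n₁ * t₂ ^ 2 + n₂ * t₁ ^ 2 - 4 * n₁ * n₂) := by
    refine Subtype.ext ?_
    rw [Subalgebra.coe_mul, hw₀, K3swap_K3trace]
    change (σ₁ x₁ ⊗ₜ x₂ + x₁ ⊗ₜ σ₂ x₂) * _ = algebraMap F (K₁ ⊗[F] K₂) _
    rw [map_sub, map_add, map_mul, map_mul, map_mul, map_mul, map_pow, map_pow, map_ofNat, T₁, T₂,
      N₁, N₂, htmul (σ₁ x₁) x₂, htmul x₁ (σ₂ x₂), htmul x₁ x₂, htmul (σ₁ x₁) (σ₂ x₂)]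
    ring
  clear_value w z
  have hprod : (w ⊗ₜ[F] (1 : K3 σ₁ σ₂) - 1 ⊗ₜ w₀) * (w ⊗ₜ[F] 1 - 1 ⊗ₜ K3swap σ₁ σ₂ w₀) =
      (z * z) ⊗ₜ 1 := by
    rw [hzz, TensorProduct.add_tmul, TensorProduct.sub_tmul, TensorProduct.smul_tmul,
      TensorProduct.smul_tmul, ← Algebra.algebraMap_eq_smul_one, ← Algebra.algebraMap_eq_smul_one,
      ← e₁, ← e₂]
    simp only [mul_sub, sub_mul, Algebra.TensorProduct.tmul_mul_tmul, one_mul, mul_one,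
      TensorProduct.tmul_add]
    abel
  have huz := hprod ▸ hu.mul hu'
  refine isUnit_of_forall_mul_eq_zero F fun x hx ↦ ?_
  have h0 : ((z * z) ⊗ₜ[F] (1 : K3 σ₁ σ₂)) * (x ⊗ₜ 1) = 0 := by
    rw [Algebra.TensorProduct.tmul_mul_tmul, mul_assoc, hx, mul_zero, TensorProduct.zero_tmul]
  rw [huz.mul_right_eq_zero] at h0
  exact Algebra.TensorProduct.includeLeft_injective (S := F) (A := B)
    (algebraMap F (K3 σ₁ σ₂)).injective (h0.trans (map_zero _).symm)

lemma baseChange_adjoin_equiv {T : Type u} [CommRing T] [Algebra F T] (w : B)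
    {s : B ⊗[F] T} {κ : Tˣ} {w₀ : T} (hs : s = (κ : T) • (w ⊗ₜ[F] (1 : T) - w₀ • 1)) :
    Nonempty (T ⊗[F] (Algebra.adjoin F {w}) ≃ₐ[T] Algebra.adjoin T {s}) := by
  let L := Algebra.adjoin F {w}
  let f : T ⊗[F] L →ₐ[T] B ⊗[F] T := Algebra.TensorProduct.lift (Algebra.ofId T _)
    ((Algebra.TensorProduct.includeLeft : B →ₐ[F] B ⊗[F] T).comp L.val)
    (fun t l ↦ Algebra.commutes _ _)
  have hf (t : T) (l : L) : f (t ⊗ₜ l) = (l : B) ⊗ₜ t := by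
    change ((1 : B) ⊗ₜ[F] t) * ((l : B) ⊗ₜ[F] (1 : T)) = _
    simp
  have hinj : Function.Injective f := by
    have : f.toLinearMap.restrictScalars F =
        (TensorProduct.comm F T B).toLinearMap ∘ₗ L.val.toLinearMap.lTensor T :=
      TensorProduct.ext' fun t l ↦ by simp [hf]
    have h2 : ⇑f = ⇑((TensorProduct.comm F T B).toLinearMap ∘ₗ L.val.toLinearMap.lTensor T) := by
      rw [← this]; rfl
    rw [h2]
    exact (TensorProduct.comm F T B).injective.comp
      (Module.Flat.lTensor_preserves_injective_linearMap _ Subtype.val_injective)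
  have hrange : f.range = Algebra.adjoin T {s} := by
    have hws : w ⊗ₜ[F] (1 : T) = ((κ⁻¹ : Tˣ) : T) • s + w₀ • 1 := by
      rw [hs, smul_smul, Units.inv_mul, one_smul, sub_add_cancel]
    refine le_antisymm ?_ ?_
    · rintro _ ⟨x, rfl⟩
      have hw : w ⊗ₜ[F] (1 : T) ∈ Algebra.adjoin T {s} := by
        rw [hws]
        exact add_mem (Subalgebra.smul_mem _ (Algebra.self_mem_adjoin_singleton _ _) _)
          (Subalgebra.smul_mem _ (one_mem _) _)
      have hl (l : B) (hl : l ∈ L) : l ⊗ₜ[F] (1 : T) ∈ Algebra.adjoin T {s} := by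
        induction hl using Algebra.adjoin_induction with
        | mem x hx => rw [Set.mem_singleton_iff.mp hx]; exact hw
        | algebraMap r =>
          have : algebraMap F B r ⊗ₜ[F] (1 : T) = algebraMap T (B ⊗[F] T) (algebraMap F T r) := by
            change _ = (1 : B) ⊗ₜ[F] (algebraMap F T r)
            rw [Algebra.algebraMap_eq_smul_one, Algebra.algebraMap_eq_smul_one,
              TensorProduct.smul_tmul]
          rw [this]
          exact Subalgebra.algebraMap_mem _ _
        | add x y _ _ hx hy => rw [TensorProduct.add_tmul]; exact add_mem hx hy
        | mul x y _ _ hx hy =>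
          have : (x * y) ⊗ₜ[F] (1 : T) = (x ⊗ₜ 1) * (y ⊗ₜ 1) := by simp
          rw [this]; exact mul_mem hx hy
      change f x ∈ _
      induction x with
      | zero => rw [map_zero]; exact zero_mem _
      | add x y hx hy => rw [map_add]; exact add_mem hx hy
      | tmul t l =>
        have : f (t ⊗ₜ l) = t • ((l : B) ⊗ₜ[F] (1 : T)) := by
          rw [hf, Algebra.smul_def]
          change _ = ((1 : B) ⊗ₜ[F] t) * ((l : B) ⊗ₜ[F] (1 : T))
          simp
        rw [this]
        exact Subalgebra.smul_mem _ (hl _ l.2) _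
    · refine Algebra.adjoin_le (Set.singleton_subset_iff.mpr ?_)
      rw [hs]
      refine Subalgebra.smul_mem _ (sub_mem ?_ (Subalgebra.smul_mem _ (one_mem _) _)) _
      exact ⟨1 ⊗ₜ ⟨w, Algebra.self_mem_adjoin_singleton _ _⟩, hf _ _⟩
  exact ⟨(AlgEquiv.ofInjective f hinj).trans (Subalgebra.equivOfEq _ _ hrange)⟩

lemma etale_adjoin_of_baseChange {T : Type u} [CommRing T] [Algebra F T] [Nontrivial T] (w : B)
    {s : B ⊗[F] T} {κ : Tˣ} {w₀ : T} (hs : s = (κ : T) • (w ⊗ₜ[F] (1 : T) - w₀ • 1))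
    (hetale : Algebra.Etale T (Algebra.adjoin T {s})) :
    Algebra.Etale F (Algebra.adjoin F {w}) ∧
      Module.finrank F (Algebra.adjoin F {w}) = Module.finrank T (Algebra.adjoin T {s}) := by
  obtain ⟨e⟩ := baseChange_adjoin_equiv w hs
  refine ⟨?_, ?_⟩
  · have : Algebra.Etale T (T ⊗[F] (Algebra.adjoin F {w})) := Algebra.Etale.of_equiv e.symm
    exact Algebra.Etale.of_etale_tensorProduct_of_faithfullyFlat T
  · rw [← e.toLinearEquiv.finrank_eq, Module.finrank_baseChange]

end RegularPair

/-- The two-sided action of a central simple algebra `B` on itself identifies `B ⊗ Bᵒᵖ` with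
`End_F B`; in particular it is faithful. -/
lemma mulLeftRight_injective (F : Type*) (B : Type*) [Field F] [Ring B] [Algebra F B]
    [FiniteDimensional F B] [Algebra.IsCentral F B] [IsSimpleRing B] :
    Function.Injective (AlgHom.mulLeftRight F B) := by
  let T := B ⊗[F] Bᵐᵒᵖ
  let : Module T B := TensorProduct.Algebra.module
  have hsmul (t : T) (x : B) : t • x = AlgHom.mulLeftRight F B t x := rfl
  have hl (b x : B) : (b ⊗ₜ[F] (1 : Bᵐᵒᵖ) : T) • x = b * x := by
    rw [hsmul, AlgHom.mulLeftRight_apply]; simp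
  have hr (b x : B) : ((1 : B) ⊗ₜ[F] MulOpposite.op b : T) • x = x * b := by
    rw [hsmul, AlgHom.mulLeftRight_apply]; simp
  have hsimple : IsSimpleModule T B := by
    rw [isSimpleModule_iff]
    refine { eq_bot_or_eq_top := fun N ↦ ?_ }
    let I : Ideal B :=
      { carrier := N
        add_mem' := N.add_mem
        zero_mem' := N.zero_mem
        smul_mem' := fun b x hx ↦ by
          rw [smul_eq_mul, ← hl]; exact N.smul_mem _ hx }
    have : I.IsTwoSided := ⟨fun {x} b hx ↦ by
      rw [← hr]; exact N.smul_mem _ hx⟩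
    rcases (isSimpleRing_iff_isTwoSided_imp.mp ‹IsSimpleRing B›).2 I this with h | h
    · exact Or.inl (SetLike.ext fun x ↦ SetLike.ext_iff.mp h x)
    · exact Or.inr (SetLike.ext fun x ↦ SetLike.ext_iff.mp h x)
  have hsurj : Function.Surjective (AlgHom.mulLeftRight F B) := by
    intro f
    have hend (φ : Module.End T B) : ∃ c : F, ∀ x, φ x = c • x := by
      have h1 (x : B) : φ x = x * φ 1 := by
        rw [← hl x (φ 1), ← map_smul, hl, mul_one]
      have h2 (x : B) : φ x = φ 1 * x := by
        rw [← hr x (φ 1), ← map_smul, hr, one_mul]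
      have hc : φ 1 ∈ Subalgebra.center F B :=
        Subalgebra.mem_center_iff.mpr fun x ↦ by rw [← h1, h2]
      obtain ⟨c, hc⟩ := Algebra.IsCentral.out hc
      refine ⟨c, fun x ↦ ?_⟩
      rw [h2, Algebra.smul_def]
      exact congrArg (· * x) hc.symm
    let f' : Module.End (Module.End T B) B :=
      { f with
        map_smul' := fun φ x ↦ by
          obtain ⟨c, hc⟩ := hend φ
          change f (φ x) = φ (f x)
          rw [hc, hc, map_smul] }
    obtain ⟨s, hs⟩ := Module.Finite.fg_top (R := F) (M := B)
    obtain ⟨r, hr⟩ := jacobson_density (R := T) f' s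
    exact ⟨r, LinearMap.ext_on hs fun x hx ↦ (hr x hx).symm⟩
  have hdim : Module.finrank F T = Module.finrank F (Module.End F B) := by
    rw [Module.finrank_tensorProduct, Module.finrank_linearMap,
      (MulOpposite.opLinearEquiv F (M := B)).symm.finrank_eq]
  exact (LinearMap.injective_iff_surjective_of_finrank_eq_finrank
    (f := (AlgHom.mulLeftRight F B).toLinearMap) hdim).mpr hsurj

/-- Over a finite-dimensional simple algebra `Q`, every nonzero module of dimension at least `dim Q`
contains a copy of `Q`. -/
lemma exists_injective_of_isSimpleRing (M Q V : Type*) [Field M] [Ring Q] [Algebra M Q]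
    [FiniteDimensional M Q] [IsSimpleRing Q] [AddCommGroup V] [Module M V] [Module Q V]
    [IsScalarTower M Q V] [FiniteDimensional M V] [Nontrivial V]
    (hle : Module.finrank M Q ≤ Module.finrank M V) :
    ∃ f : Q →ₗ[Q] V, Function.Injective f := by
  have : IsArtinianRing Q := IsArtinianRing.of_finite M Q
  have : Module.Finite Q V := Module.Finite.of_restrictScalars_finite M Q V
  obtain ⟨k, _, S, hS, ⟨eV⟩⟩ := (IsSimpleRing.isIsotypic Q V).linearEquiv_fun
  obtain ⟨I, ⟨eI⟩⟩ := IsSemisimpleRing.exists_linearEquiv_ideal_of_isSimpleModule Q S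
  have : IsSimpleModule Q I := IsSimpleModule.congr eI.symm
  obtain ⟨n, ⟨eQ⟩⟩ :=
    ((IsSimpleRing.isIsotypic Q Q I).of_linearEquiv_type eI.symm).linearEquiv_fun
  have hnt : Nontrivial S := IsSimpleModule.nontrivial Q S
  have : FiniteDimensional M S :=
    FiniteDimensional.of_injective ((S.restrictScalars M).subtype) Subtype.val_injective
  have hpos : 0 < Module.finrank M S := Module.finrank_pos
  have hn : Module.finrank M Q = n * Module.finrank M S := by
    rw [(eQ.restrictScalars M).finrank_eq, Module.finrank_pi_fintype]; simp
  have hk : Module.finrank M V = k * Module.finrank M S := by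
    rw [(eV.restrictScalars M).finrank_eq, Module.finrank_pi_fintype]; simp
  rw [hn, hk] at hle
  have hnk : n ≤ k := Nat.le_of_mul_le_mul_right hle hpos
  have : Nonempty (Fin n) := by
    by_contra hcon
    rw [not_nonempty_iff] at hcon
    exact not_subsingleton Q eQ.toEquiv.subsingleton
  refine ⟨eV.symm.toLinearMap ∘ₗ LinearMap.funLeft Q S (Function.invFun (Fin.castLE hnk)) ∘ₗ
    eQ.toLinearMap, ?_⟩
  exact eV.symm.injective.comp ((LinearMap.funLeft_injective_of_surjective Q S _
    (Function.invFun_surjective (Fin.castLE_injective hnk))).comp eQ.injective)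

section FieldCase

variable {M V : Type*} [Field M] [AddCommGroup V] [Module M V] [FiniteDimensional M V]
  [Nontrivial V] {α β γ δ : Module.End M V}

/-- Two commuting quaternion-like pairs force the dimension to be at least `4`. -/
lemma four_le_finrank_of_commuting_pairs (hz : IsUnit (α * β - β * α))
    (hz' : IsUnit (γ * δ - δ * γ)) (hαγ : Commute α γ) (hαδ : Commute α δ) (hβγ : Commute β γ)
    (hβδ : Commute β δ) : 4 ≤ Module.finrank M V := by
  have hword (x : Module.End M V) (h1 : Commute x γ) (h2 : Commute x δ) (j) :
      Commute (quatWord γ δ j) x := by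
    fin_cases j <;> simp [quatWord, h1.symm, h2.symm, Commute.mul_left]
  have hli : LinearIndependent M
      (fun p : Fin 4 × Fin 4 ↦ quatWord γ δ p.2 * quatWord α β p.1) := by
    rw [Fintype.linearIndependent_iff]
    intro c hc
    have hcomm (x : Module.End M V) (h1 : Commute x γ) (h2 : Commute x δ) (i) :
        Commute (∑ j, c (i, j) • quatWord γ δ j) x :=
      Commute.sum_left _ _ _ fun j _ ↦ (hword x h1 h2 j).smul_left _
    have h1 := eq_zero_of_sum_quatWord_eq_zero hz (fun i ↦ ∑ j, c (i, j) • quatWord γ δ j)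
      (hcomm α hαγ hαδ) (hcomm β hβγ hβδ) (by
        rw [← hc, Fintype.sum_prod_type]
        simp [Finset.sum_mul])
    rintro ⟨i, j⟩
    have h2 := eq_zero_of_sum_quatWord_eq_zero hz'
      (fun j ↦ algebraMap M (Module.End M V) (c (i, j)))
      (fun j ↦ Algebra.commutes _ _) (fun j ↦ Algebra.commutes _ _) (by
        simpa [Algebra.smul_def] using congrFun h1 i)
    exact (map_eq_zero_iff _ (algebraMap M (Module.End M V)).injective).mp (congrFun h2 j)
  have h16 := hli.fintype_card_le_finrank
  rw [Module.finrank_linearMap] at h16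
  simp only [Fintype.card_prod, Fintype.card_fin] at h16
  nlinarith

lemma exists_cyclic_vector_of_field {t₁ n₁ t₂ n₂ q : M} (haa : α * α = t₁ • α - n₁ • 1)
    (hbb : β * β = t₂ • β - n₂ • 1) (hba : β * α = q • 1 + t₂ • α + t₁ • β - α * β)
    (hz : IsUnit (α * β - β * α))
    (hz' : IsUnit (γ * δ - δ * γ)) (hαγ : Commute α γ) (hαδ : Commute α δ) (hβγ : Commute β γ)
    (hβδ : Commute β δ) :
    ∃ v : V, ∀ c : Fin 4 → M, ∑ i, c i • quatWord α β i v = 0 → c = 0 := by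
  let Q := Algebra.adjoin M ({α, β} : Set (Module.End M V))
  have hα : α ∈ Q := Algebra.subset_adjoin (by simp)
  have hβ : β ∈ Q := Algebra.subset_adjoin (by simp)
  let a : Q := ⟨α, hα⟩
  let b : Q := ⟨β, hβ⟩
  have hspan (x : Q) : ∃ c : Fin 4 → M, x = ∑ i, algebraMap M Q (c i) * quatWord a b i := by
    obtain ⟨c, hc, hx⟩ := exists_eq_sum_quatWord_of_mem_adjoin (⊥ : Subalgebra M (Module.End M V))
      (a := α) (b := β)
      (fun s hs ↦ by obtain ⟨r, rfl⟩ := Algebra.mem_bot.mp hs; exact Algebra.commutes _ _)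
      (fun s hs ↦ by obtain ⟨r, rfl⟩ := Algebra.mem_bot.mp hs; exact Algebra.commutes _ _)
      (Subalgebra.algebraMap_mem _ t₁) (Subalgebra.algebraMap_mem _ n₁)
      (Subalgebra.algebraMap_mem _ t₂) (Subalgebra.algebraMap_mem _ n₂)
      (Subalgebra.algebraMap_mem _ q)
      (by simpa [Algebra.smul_def] using haa) (by simpa [Algebra.smul_def] using hbb)
      (by simpa [Algebra.smul_def] using hba) x.2
    choose d hd using fun i ↦ Algebra.mem_bot.mp (hc i)
    refine ⟨d, Subtype.ext ?_⟩
    rw [hx, ← Q.val_apply, map_sum]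
    refine Finset.sum_congr rfl fun i _ ↦ ?_
    rw [map_mul, ← hd i]
    congr 1
    exact (map_quatWord (Q.val : Q →+* Module.End M V) a b i).symm
  have hQ4 : Module.finrank M Q ≤ 4 := by
    have := LinearMap.finrank_le_finrank_of_surjective
      (f := Fintype.linearCombination M (quatWord a b)) (fun x ↦ by
        obtain ⟨c, hc⟩ := hspan x
        exact ⟨c, by rw [hc, Fintype.linearCombination_apply]; simp [Algebra.smul_def]⟩)
    simpa using this
  have hzQ : IsUnit (a * b - b * a) := by
    refine isUnit_of_forall_mul_eq_zero M fun x hx ↦ Subtype.ext ?_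
    have : (α * β - β * α) * (x : Module.End M V) = 0 := congrArg Subtype.val hx
    exact hz.mul_right_eq_zero.mp this
  have hsimple : IsSimpleRing Q := by
    rw [isSimpleRing_iff_isTwoSided_imp]
    refine ⟨inferInstance, fun I hI ↦ ?_⟩
    rw [or_iff_not_imp_left, Submodule.eq_bot_iff]
    intro hne
    push Not at hne
    obtain ⟨x, hx, hx0⟩ := hne
    by_contra htop
    have hscal (r : M) (hr : algebraMap M Q r ∈ I) : r = 0 := by
      by_contra hr0
      exact htop (I.eq_top_of_isUnit_mem hr ((IsUnit.mk0 r hr0).map _))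
    have hcommut (c : Fin 4 → M) (hc : ∑ i, algebraMap M Q (c i) * quatWord a b i ∈ I) :
        c 2 = 0 ∧ c 3 = 0 ∧ c 1 = 0 ∧ c 0 = 0 := by
      have hcancel {y : Q} (hy : y * (a * b - b * a) ∈ I) : y ∈ I := by
        obtain ⟨z, hz⟩ := hzQ.exists_right_inv
        simpa [mul_assoc, hz] using I.mul_mem_right z hy
      have hbr {y : Q} (u : Q) (hy : y ∈ I) : u * y - y * u ∈ I :=
        sub_mem (I.mul_mem_left u hy) (I.mul_mem_right u hy)
      have hlin (r s : M) (hrs : algebraMap M Q r + algebraMap M Q s * a ∈ I) :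
          r = 0 ∧ s = 0 := by
        have hs : s = 0 := by
          refine hscal s (hcancel ?_)
          have e : algebraMap M Q s * (a * b - b * a) =
              -(b * (algebraMap M Q r + algebraMap M Q s * a) -
                (algebraMap M Q r + algebraMap M Q s * a) * b) := by
            rw [mul_add, add_mul, Algebra.commutes r b, Algebra.left_comm, mul_sub, mul_assoc]
            abel
          rw [e]
          exact neg_mem (hbr b hrs)
        subst hs
        exact ⟨hscal r (by simpa using hrs), rfl⟩
      have hbr_a := hbr a hc
      rw [commutator_left_sum_quatWord _ fun i ↦ Algebra.commutes _ _] at hbr_a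
      obtain ⟨h2, h3⟩ := hlin _ _ (hcancel hbr_a)
      rw [sum_mul_quatWord, h2, h3] at hc
      obtain ⟨h0, h1⟩ := hlin (c 0) (c 1) (by simpa using hc)
      exact ⟨h2, h3, h1, h0⟩
    obtain ⟨c, rfl⟩ := hspan x
    obtain ⟨h2, h3, h1, h0⟩ := hcommut c hx
    apply hx0
    rw [sum_mul_quatWord, h0, h1, h2, h3]
    simp
  obtain ⟨f, hf⟩ := exists_injective_of_isSimpleRing M Q V
    (hQ4.trans (four_le_finrank_of_commuting_pairs hz hz' hαγ hαδ hβγ hβδ))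
  refine ⟨f 1, fun c hc ↦ ?_⟩
  have hfx : f (∑ i, algebraMap M Q (c i) * quatWord a b i) = 0 := by
    rw [← hc, map_sum]
    refine Finset.sum_congr rfl fun i _ ↦ ?_
    rw [← mul_one (algebraMap M Q (c i) * quatWord a b i), ← smul_eq_mul, map_smul, mul_smul,
      algebraMap_smul]
    congr 1
    change ((quatWord a b i : Q) : Module.End M V) (f 1) = _
    exact LinearMap.congr_fun (map_quatWord (Q.val : Q →+* Module.End M V) a b i) _
  have h0 := eq_zero_of_sum_quatWord_eq_zero hzQ _ (fun i ↦ Algebra.commutes _ _)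
    (fun i ↦ Algebra.commutes _ _) (hf (hfx.trans (map_zero f).symm))
  ext i
  exact (map_eq_zero_iff _ (algebraMap M Q).injective).mp (congrFun h0 i)

end FieldCase

lemma exists_cyclic_vector {R B : Type*} [CommRing R] [IsArtinianRing R] [IsReduced R]
    [AddCommGroup B] [Module R B] [Module.Finite R B] [FaithfulSMul R B] {α β γ δ : Module.End R B}
    {t₁ n₁ t₂ n₂ q : R} (haa : α * α = t₁ • α - n₁ • 1)
    (hbb : β * β = t₂ • β - n₂ • 1) (hba : β * α = q • 1 + t₂ • α + t₁ • β - α * β)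
    (hz : IsUnit (α * β - β * α))
    (hz' : IsUnit (γ * δ - δ * γ)) (hαγ : Commute α γ) (hαδ : Commute α δ) (hβγ : Commute β γ)
    (hβδ : Commute β δ) :
    ∃ u : B, ∀ c : Fin 4 → R, ∑ i, c i • quatWord α β i u = 0 → c = 0 := by
  classical
  have : Finite (MaximalSpectrum R) := inferInstance
  have : Fintype (MaximalSpectrum R) := Fintype.ofFinite _
  let e (m : MaximalSpectrum R) : R := (IsArtinianRing.equivPi R).symm (Pi.single m 1)
  have he (m m' : MaximalSpectrum R) :
      Ideal.Quotient.mk m'.asIdeal (e m) = if m' = m then 1 else 0 := by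
    have h := congrFun ((IsArtinianRing.equivPi R).apply_symm_apply (Pi.single m 1)) m'
    split_ifs with hm
    · subst hm
      exact h.trans (Pi.single_eq_same _ _)
    · exact h.trans (Pi.single_eq_of_ne hm _)
  have hzero (r : R) (hr : ∀ m : MaximalSpectrum R, Ideal.Quotient.mk m.asIdeal r = 0) : r = 0 := by
    apply (IsArtinianRing.equivPi R).injective
    rw [map_zero]
    exact funext hr
  have hem (m : MaximalSpectrum R) (r : R) (hr : r ∈ m.asIdeal) : e m * r = 0 := by
    refine hzero _ fun m' ↦ ?_
    rw [map_mul, he]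
    split_ifs with h
    · subst h
      rw [one_mul, Ideal.Quotient.eq_zero_iff_mem.mpr hr]
    · rw [zero_mul]
  have local_vector (m : MaximalSpectrum R) :
      ∃ v : (R ⧸ m.asIdeal) ⊗[R] B, ∀ c : Fin 4 → R ⧸ m.asIdeal,
        ∑ i, c i • (quatWord α β i).baseChange (R ⧸ m.asIdeal) v = 0 → c = 0 := by
    let : Field (R ⧸ m.asIdeal) := Ideal.Quotient.field m.asIdeal
    let φ := Module.End.baseChangeHom R (R ⧸ m.asIdeal) B
    have hφ (r : R) (f : Module.End R B) :
        φ (r • f) = (Ideal.Quotient.mk m.asIdeal r) • φ f := by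
      rw [map_smul]
      exact (algebraMap_smul (R ⧸ m.asIdeal) r (φ f)).symm
    have : Nontrivial ((R ⧸ m.asIdeal) ⊗[R] B) := by
      have hm0 : e m ≠ 0 := by
        intro h
        have := he m m
        rw [h, map_zero, if_pos rfl] at this
        exact zero_ne_one this
      obtain ⟨b, hb⟩ : ∃ b : B, e m • b ≠ 0 := by
        by_contra! hcon
        exact hm0 (FaithfulSMul.eq_of_smul_eq_smul (α := B) fun b ↦ by rw [hcon, zero_smul])
      let g : (R ⧸ m.asIdeal) ⊗[R] B →ₗ[R] B := TensorProduct.lift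
        (Submodule.liftQ m.asIdeal ((LinearMap.lsmul R B) ∘ₗ LinearMap.mulLeft R (e m))
          (fun r hr ↦ LinearMap.ext fun b ↦ by simp [hem m r hr]))
      refine ⟨⟨1 ⊗ₜ b, 0, fun h ↦ hb ?_⟩⟩
      have : g (1 ⊗ₜ b) = (e m * 1) • b := rfl
      rw [← mul_one (e m), ← this, h, map_zero]
    obtain ⟨v, hv⟩ := exists_cyclic_vector_of_field (M := R ⧸ m.asIdeal) (α := φ α) (β := φ β)
      (γ := φ γ) (δ := φ δ) (by rw [← map_mul, haa, map_sub, hφ, hφ, map_one])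
      (by rw [← map_mul, hbb, map_sub, hφ, hφ, map_one])
      (by rw [← map_mul, hba, map_sub, map_add, map_add, hφ, hφ, hφ, map_one, map_mul])
      (by simpa using hz.map φ) (by simpa using hz'.map φ) (hαγ.map φ) (hαδ.map φ) (hβγ.map φ)
      (hβδ.map φ)
    refine ⟨v, fun c hc ↦ hv c ?_⟩
    rw [← hc]
    refine Finset.sum_congr rfl fun i _ ↦ ?_
    have h : φ (quatWord α β i) = quatWord (φ α) (φ β) i := by fin_cases i <;> simp [quatWord]
    exact congrArg (c i • ·) (LinearMap.congr_fun h v).symm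
  choose v hv using local_vector
  have hπ (m : MaximalSpectrum R) : ∃ b : B, (1 : R ⧸ m.asIdeal) ⊗ₜ[R] b = v m :=
    TensorProduct.mk_surjective R B (R ⧸ m.asIdeal) Ideal.Quotient.mk_surjective (v m)
  choose b hb using hπ
  refine ⟨∑ m, e m • b m, fun c hc ↦ ?_⟩
  have hu (m : MaximalSpectrum R) : (1 : R ⧸ m.asIdeal) ⊗ₜ[R] (∑ m, e m • b m) = v m := by
    rw [TensorProduct.tmul_sum, Finset.sum_eq_single m]
    · rw [← TensorProduct.smul_tmul, ← Algebra.algebraMap_eq_smul_one, Ideal.Quotient.algebraMap_eq,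
        he, if_pos rfl, hb]
    · intro m' _ hne
      rw [← TensorProduct.smul_tmul, ← Algebra.algebraMap_eq_smul_one, Ideal.Quotient.algebraMap_eq,
        he, if_neg hne.symm, TensorProduct.zero_tmul]
    · simp
  ext i
  refine hzero _ fun m ↦ ?_
  refine congrFun (hv m (fun i ↦ Ideal.Quotient.mk m.asIdeal (c i)) ?_) i
  have := congrArg (fun x ↦ (1 : R ⧸ m.asIdeal) ⊗ₜ[R] x) hc
  simp only [TensorProduct.tmul_sum, TensorProduct.tmul_zero] at this
  rw [← this, ← hu m]
  refine Finset.sum_congr rfl fun i _ ↦ ?_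
  rw [LinearMap.baseChange_tmul, TensorProduct.tmul_smul]
  exact algebraMap_smul (R ⧸ m.asIdeal) (c i) _

section BiAction

variable {F T B : Type*} [Field F] [CommRing T] [Algebra F T] [Ring B] [Algebra F B]

/-- The action of `T ⊗ T` on `B` by `(x ⊗ y) • v = ι x * v * ι y`. -/
noncomputable def biAction (ι : T →ₐ[F] B) : T ⊗[F] T →ₐ[F] Module.End F B :=
  (AlgHom.mulLeftRight F B).comp (Algebra.TensorProduct.map ι
    (ι.toOpposite fun x y ↦ (Commute.all x y).map ι))

lemma biAction_tmul (ι : T →ₐ[F] B) (x y : T) (v : B) :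
    biAction ι (x ⊗ₜ y) v = ι x * v * ι y := by
  simp [biAction, AlgHom.mulLeftRight_apply]

lemma biAction_injective [FiniteDimensional F B] [Algebra.IsCentral F B] [IsSimpleRing B]
    {ι : T →ₐ[F] B} (hι : Function.Injective ι) : Function.Injective (biAction ι) := by
  refine (mulLeftRight_injective F B).comp ?_
  refine TensorProduct.map_injective_of_flat_flat (R := F) ι.toLinearMap
    (ι.toOpposite fun x y ↦ (Commute.all x y).map ι).toLinearMap hι fun x y hxy ↦ hι ?_
  exact MulOpposite.op_injective hxy

lemma biAction_mul_right {ι : T →ₐ[F] B} {a : B} (ha : ∀ x, Commute (ι x) a) (r : T ⊗[F] T)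
    (v : B) : biAction ι r (v * a) = biAction ι r v * a := by
  induction r using TensorProduct.induction_on with
  | zero => simp
  | tmul x y => simp only [biAction_tmul, mul_assoc, (ha y).eq]
  | add r s hr hs => simp only [map_add, LinearMap.add_apply, hr, hs, add_mul]

lemma biAction_mul_left {ι : T →ₐ[F] B} {a : B} (ha : ∀ x, Commute (ι x) a) (r : T ⊗[F] T)
    (v : B) : biAction ι r (a * v) = a * biAction ι r v := by
  induction r using TensorProduct.induction_on with
  | zero => simp
  | tmul x y => simp only [biAction_tmul, ← mul_assoc, (ha x).eq]
  | add r s hr hs => simp only [map_add, LinearMap.add_apply, hr, hs, mul_add]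

lemma exists_biAction_cyclic [FiniteDimensional F B] [Algebra.IsCentral F B] [IsSimpleRing B]
    [Algebra.Etale F T] {ι : T →ₐ[F] B} (hι : Function.Injective ι) {a b : B}
    (ha : ∀ x, Commute (ι x) a) (hb : ∀ x, Commute (ι x) b) {t₁ n₁ t₂ n₂ : F} {q : T}
    (haa : a * a = t₁ • a - n₁ • 1) (hbb : b * b = t₂ • b - n₂ • 1)
    (hba : b * a = ι q + t₂ • a + t₁ • b - a * b) (hz : IsUnit (a * b - b * a)) :
    ∃ u : B, ∀ c : Fin 4 → T ⊗[F] T, ∑ i, biAction ι (c i) (quatWord a b i * u) = 0 → c = 0 := by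
  have : FiniteDimensional F T := FiniteDimensional.of_injective ι.toLinearMap hι
  let : Algebra T (T ⊗[F] T) := Algebra.TensorProduct.leftAlgebra
  have : Algebra.Etale F (T ⊗[F] T) := Algebra.Etale.comp F T (T ⊗[F] T)
  have : IsReduced (T ⊗[F] T) := Algebra.FormallyUnramified.isReduced_of_field F (T ⊗[F] T)
  have : IsArtinianRing (T ⊗[F] T) := IsArtinianRing.of_finite F _
  let : Module (T ⊗[F] T) B := Module.compHom B (biAction ι).toRingHom
  have hsmul (r : T ⊗[F] T) (v : B) : r • v = biAction ι r v := rfl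
  have : IsScalarTower F (T ⊗[F] T) B := ⟨fun c r v ↦ by simp [hsmul]⟩
  have : Module.Finite (T ⊗[F] T) B := Module.Finite.of_restrictScalars_finite F _ _
  have : FaithfulSMul (T ⊗[F] T) B :=
    ⟨fun {r s} h ↦ biAction_injective hι (LinearMap.ext h)⟩
  let left (x : B) (hx : ∀ y, Commute (ι y) x) : Module.End (T ⊗[F] T) B :=
    { toFun := fun v ↦ x * v
      map_add' := fun v v' ↦ mul_add x v v'
      map_smul' := fun r v ↦ (biAction_mul_left hx r v).symm }
  let right (x : B) (hx : ∀ y, Commute (ι y) x) : Module.End (T ⊗[F] T) B :=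
    { toFun := fun v ↦ v * x
      map_add' := fun v v' ↦ add_mul v v' x
      map_smul' := fun r v ↦ (biAction_mul_right hx r v).symm }
  have hc (t : F) (v : B) : (algebraMap F (T ⊗[F] T) t) • v = t • v := algebraMap_smul _ _ _
  have hq (v : B) : (q ⊗ₜ[F] (1 : T)) • v = ι q * v := by rw [hsmul, biAction_tmul]; simp
  obtain ⟨u, hu⟩ := exists_cyclic_vector (R := T ⊗[F] T) (B := B) (α := left a ha) (β := left b hb)
    (γ := right a ha) (δ := right b hb) (t₁ := algebraMap F _ t₁) (n₁ := algebraMap F _ n₁)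
    (t₂ := algebraMap F _ t₂) (n₂ := algebraMap F _ n₂) (q := q ⊗ₜ 1)
    (by ext v
        change a * (a * v) = algebraMap F (T ⊗[F] T) t₁ • (a * v) - algebraMap F (T ⊗[F] T) n₁ • v
        rw [hc, hc, ← mul_assoc, haa]; simp [sub_mul])
    (by ext v
        change b * (b * v) = algebraMap F (T ⊗[F] T) t₂ • (b * v) - algebraMap F (T ⊗[F] T) n₂ • v
        rw [hc, hc, ← mul_assoc, hbb]; simp [sub_mul])
    (by ext v
        change b * (a * v) = (q ⊗ₜ[F] (1 : T)) • v + algebraMap F (T ⊗[F] T) t₂ • (a * v) +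
          algebraMap F (T ⊗[F] T) t₁ • (b * v) - a * (b * v)
        rw [hc, hc, hq, ← mul_assoc, hba]; simp [sub_mul, add_mul, mul_assoc])
    (by
      rw [Module.End.isUnit_iff]
      have h (v : B) : (left a ha * left b hb - left b hb * left a ha) v = (a * b - b * a) * v := by
        change a * (b * v) - b * (a * v) = _
        rw [sub_mul, mul_assoc, mul_assoc]
      convert hz.unit.mulLeft.bijective using 1
      exact funext h)
    (by
      rw [Module.End.isUnit_iff]
      have h (v : B) : (right a ha * right b hb - right b hb * right a ha) v =
          v * -(a * b - b * a) := by
        change v * b * a - v * a * b = _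
        rw [neg_sub, mul_sub, mul_assoc, mul_assoc]
      convert hz.neg.unit.mulRight.bijective using 1
      exact funext h)
    (LinearMap.ext fun v ↦ (mul_assoc a v a).symm) (LinearMap.ext fun v ↦ (mul_assoc a v b).symm)
    (LinearMap.ext fun v ↦ (mul_assoc b v a).symm) (LinearMap.ext fun v ↦ (mul_assoc b v b).symm)
  refine ⟨u, fun c h ↦ hu c ?_⟩
  rw [← h]
  refine Finset.sum_congr rfl fun i _ ↦ ?_
  rw [hsmul]
  congr 1
  fin_cases i <;> simp [quatWord, left, mul_assoc]

lemma finrank_ker_mul_sub_le [FiniteDimensional F T] {t : T} (ht : Algebra.adjoin F {t} = ⊤) :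
    Module.finrank F (LinearMap.ker (LinearMap.mulLeft F (t ⊗ₜ[F] (1 : T) - 1 ⊗ₜ t))) ≤
      Module.finrank F T := by
  set r : T ⊗[F] T := t ⊗ₜ 1 - 1 ⊗ₜ t with hr
  have hmem (s : T) : (1 : T) ⊗ₜ[F] s - s ⊗ₜ 1 ∈ Ideal.span {r} := by
    have hs : s ∈ Algebra.adjoin F {t} := ht ▸ Algebra.mem_top
    induction hs using Algebra.adjoin_induction with
    | mem x hx =>
      obtain rfl : x = t := hx
      rw [← neg_sub]
      exact neg_mem (Ideal.mem_span_singleton_self r)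
    | algebraMap c =>
      rw [Algebra.algebraMap_eq_smul_one, TensorProduct.smul_tmul, sub_self]
      exact zero_mem _
    | add x y _ _ hx hy =>
      rw [TensorProduct.tmul_add, TensorProduct.add_tmul, add_sub_add_comm]
      exact add_mem hx hy
    | mul x y _ _ hx hy =>
      have : (1 : T) ⊗ₜ[F] (x * y) - (x * y) ⊗ₜ 1 =
          (1 ⊗ₜ x) * (1 ⊗ₜ y - y ⊗ₜ 1) + (y ⊗ₜ 1) * (1 ⊗ₜ x - x ⊗ₜ 1) := by
        simp only [mul_sub, Algebra.TensorProduct.tmul_mul_tmul, one_mul, mul_one, mul_comm y x]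
        abel
      rw [this]
      exact add_mem (Ideal.mul_mem_left _ _ hy) (Ideal.mul_mem_left _ _ hx)
  have hle : LinearMap.ker (LinearMap.mul' F T) ≤ LinearMap.range (LinearMap.mulLeft F r) := by
    intro x hx
    have hx' : x ∈ KaehlerDifferential.ideal F T := hx
    rw [← KaehlerDifferential.span_range_eq_ideal] at hx'
    have : Ideal.span (Set.range fun s : T ↦ (1 : T) ⊗ₜ[F] s - s ⊗ₜ[F] (1 : T)) ≤
        Ideal.span {r} := Ideal.span_le.mpr (by rintro _ ⟨s, rfl⟩; exact hmem s)
    obtain ⟨y, rfl⟩ := Ideal.mem_span_singleton'.mp (this hx')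
    exact ⟨y, mul_comm r y⟩
  have h₁ := LinearMap.finrank_range_add_finrank_ker (LinearMap.mul' F T)
  have h₂ := LinearMap.finrank_range_add_finrank_ker (LinearMap.mulLeft F r)
  have h₃ := Submodule.finrank_mono hle
  have h₄ := (LinearMap.range (LinearMap.mul' F T)).finrank_le
  omega

/-- The map sending coefficients `c` in `T ⊗ T` to `∑ cᵢ • (mᵢ u)`, with `mᵢ` the words
`1, a, b, ab`. -/
noncomputable def biSum (ι : T →ₐ[F] B) (a b u : B) : (Fin 4 → T ⊗[F] T) →ₗ[F] B :=
  ∑ i, (LinearMap.applyₗ (quatWord a b i * u)) ∘ₗ (biAction ι).toLinearMap ∘ₗ LinearMap.proj i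

lemma biSum_apply (ι : T →ₐ[F] B) (a b u : B) (c : Fin 4 → T ⊗[F] T) :
    biSum ι a b u c = ∑ i, biAction ι (c i) (quatWord a b i * u) := by
  simp [biSum]

lemma exists_biSum_bijective [FiniteDimensional F B] [Algebra.IsCentral F B] [IsSimpleRing B]
    [Algebra.Etale F T] (hdim : Module.finrank F B = 4 * Module.finrank F T ^ 2)
    {ι : T →ₐ[F] B} (hι : Function.Injective ι) {a b : B}
    (ha : ∀ x, Commute (ι x) a) (hb : ∀ x, Commute (ι x) b) {t₁ n₁ t₂ n₂ : F} {q : T}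
    (haa : a * a = t₁ • a - n₁ • 1) (hbb : b * b = t₂ • b - n₂ • 1)
    (hba : b * a = ι q + t₂ • a + t₁ • b - a * b) (hz : IsUnit (a * b - b * a)) :
    ∃ u : B, Function.Bijective (biSum ι a b u) := by
  obtain ⟨u, hu⟩ := exists_biAction_cyclic hι ha hb haa hbb hba hz
  have : FiniteDimensional F T := FiniteDimensional.of_injective ι.toLinearMap hι
  have hinj : Function.Injective (biSum ι a b u) := by
    rw [injective_iff_map_eq_zero]
    intro c hc
    exact hu c (by rw [← biSum_apply, hc])
  refine ⟨u, hinj, (LinearMap.injective_iff_surjective_of_finrank_eq_finrank ?_).mp hinj⟩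
  rw [hdim, Module.finrank_pi_fintype]
  simp [Module.finrank_tensorProduct, sq]

/-- The map sending coefficients `c` in `T` to `∑ cᵢ mᵢ`, with `mᵢ` the words `1, a, b, ab`. -/
noncomputable def quatSum (ι : T →ₐ[F] B) (a b : B) : (Fin 4 → T) →ₗ[F] B :=
  ∑ i, (LinearMap.mulRight F (quatWord a b i)) ∘ₗ ι.toLinearMap ∘ₗ LinearMap.proj i

lemma quatSum_apply (ι : T →ₐ[F] B) (a b : B) (c : Fin 4 → T) :
    quatSum ι a b c = ∑ i, ι (c i) * quatWord a b i := by
  simp [quatSum]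

lemma quatSum_injective {ι : T →ₐ[F] B} (hι : Function.Injective ι) {a b : B}
    (ha : ∀ x, Commute (ι x) a) (hb : ∀ x, Commute (ι x) b) (hz : IsUnit (a * b - b * a)) :
    Function.Injective (quatSum ι a b) := by
  rw [injective_iff_map_eq_zero]
  intro c hc
  rw [quatSum_apply] at hc
  have := eq_zero_of_sum_quatWord_eq_zero hz (fun i ↦ ι (c i)) (fun i ↦ ha _) (fun i ↦ hb _) hc
  exact funext fun i ↦ hι (by rw [congrFun this i]; simp)

lemma range_quatSum {ι : T →ₐ[F] B} {a b : B}
    (ha : ∀ x, Commute (ι x) a) (hb : ∀ x, Commute (ι x) b) {t₁ n₁ t₂ n₂ : F} {q : T}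
    (haa : a * a = t₁ • a - n₁ • 1) (hbb : b * b = t₂ • b - n₂ • 1)
    (hba : b * a = ι q + t₂ • a + t₁ • b - a * b) (hle : ι.range ≤ Algebra.adjoin F {a, b}) :
    LinearMap.range (quatSum ι a b) = (Algebra.adjoin F {a, b}).toSubmodule := by
  apply le_antisymm
  · rintro _ ⟨c, rfl⟩
    rw [quatSum_apply, Subalgebra.mem_toSubmodule]
    refine sum_mem fun i _ ↦ mul_mem (hle ⟨c i, rfl⟩) ?_
    have h₁ : a ∈ Algebra.adjoin F {a, b} := Algebra.subset_adjoin (by simp)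
    have h₂ : b ∈ Algebra.adjoin F {a, b} := Algebra.subset_adjoin (by simp)
    fin_cases i
    exacts [one_mem _, h₁, h₂, mul_mem h₁ h₂]
  · intro x hx
    have hF (t : F) : algebraMap F B t ∈ ι.range := ι.range.algebraMap_mem t
    obtain ⟨c, hc, rfl⟩ := exists_eq_sum_quatWord_of_mem_adjoin ι.range
      (by rintro _ ⟨x, rfl⟩; exact ha x) (by rintro _ ⟨x, rfl⟩; exact hb x) (hF t₁) (hF n₁) (hF t₂)
      (hF n₂) (q := ι q) ⟨q, rfl⟩ (by rw [haa]; simp [Algebra.smul_def])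
      (by rw [hbb]; simp [Algebra.smul_def]) (by rw [hba]; simp [Algebra.smul_def]) hx
    choose d hd using hc
    exact ⟨d, by rw [quatSum_apply]; exact Finset.sum_congr rfl fun i _ ↦ congrArg (· * _) (hd i)⟩

lemma centralizer_range_eq [FiniteDimensional F B] [FiniteDimensional F T]
    {ι : T →ₐ[F] B} (hι : Function.Injective ι) {t : T} (ht : Algebra.adjoin F {t} = ⊤) {a b u : B}
    (ha : ∀ x, Commute (ι x) a) (hb : ∀ x, Commute (ι x) b)
    (hz : IsUnit (a * b - b * a))
    (hrange : LinearMap.range (quatSum ι a b) = (Algebra.adjoin F {a, b}).toSubmodule)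
    (hu : Function.Bijective (biSum ι a b u)) :
    Subalgebra.centralizer F (ι.range : Set B) = Algebra.adjoin F {a, b} := by
  set r : T ⊗[F] T := t ⊗ₜ 1 - 1 ⊗ₜ t with hr
  set N := LinearMap.ker (LinearMap.mulLeft F r) with hN
  have hle : Algebra.adjoin F {a, b} ≤ Subalgebra.centralizer F (ι.range : Set B) := by
    refine Algebra.adjoin_le ?_
    rintro _ (rfl | rfl) _ ⟨x, rfl⟩
    exacts [ha x, hb x]
  have hcentral : (Subalgebra.centralizer F (ι.range : Set B)).toSubmodule ≤
      LinearMap.range (biSum ι a b u ∘ₗ N.subtype.compLeft (Fin 4)) := by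
    intro x hx
    obtain ⟨c, rfl⟩ := hu.2 x
    have h : biSum ι a b u (r • c) = 0 := by
      have h₁ : biSum ι a b u (r • c) = biAction ι r (biSum ι a b u c) := by
        simp [biSum_apply, map_sum]
      have h₂ := hx (ι t) ⟨t, rfl⟩
      rw [h₁, hr, map_sub, LinearMap.sub_apply, biAction_tmul, biAction_tmul, map_one, one_mul,
        mul_one, h₂, sub_self]
    have h0 := hu.1 (h.trans (map_zero _).symm)
    exact ⟨fun i ↦ ⟨c i, congrFun h0 i⟩, rfl⟩
  have h₁ := (Submodule.finrank_mono hcentral).trans (LinearMap.finrank_range_le _)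
  have h₂ : Module.finrank F (Algebra.adjoin F {a, b}).toSubmodule = 4 * Module.finrank F T := by
    rw [← hrange, LinearMap.finrank_range_of_inj (quatSum_injective hι ha hb hz)]
    simp [Module.finrank_pi_fintype]
  have h₃ : Module.finrank F N ≤ Module.finrank F T := finrank_ker_mul_sub_le ht
  rw [Module.finrank_pi_fintype, Finset.sum_const, Finset.card_univ, Fintype.card_fin,
    smul_eq_mul] at h₁
  exact (Subalgebra.toSubmodule_injective (Submodule.eq_of_le_of_finrank_le hle (by omega))).symm

lemma centralizer_adjoin_eq {ι : T →ₐ[F] B} {a b : B}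
    (ha : ∀ x, Commute (ι x) a) (hb : ∀ x, Commute (ι x) b) (hz : IsUnit (a * b - b * a))
    (hle : ι.range ≤ Algebra.adjoin F {a, b})
    (hrange : LinearMap.range (quatSum ι a b) = (Algebra.adjoin F {a, b}).toSubmodule)
    (hcent : Subalgebra.centralizer F (ι.range : Set B) = Algebra.adjoin F {a, b}) :
    Subalgebra.centralizer F (Algebra.adjoin F {a, b} : Set B) = ι.range := by
  apply le_antisymm
  · intro x hx
    have h₁ : x ∈ (Algebra.adjoin F {a, b}).toSubmodule := by
      rw [Subalgebra.mem_toSubmodule, ← hcent]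
      exact fun y hy ↦ hx y (hle hy)
    rw [← hrange] at h₁
    obtain ⟨c, rfl⟩ := h₁
    rw [quatSum_apply] at hx ⊢
    exact ⟨c 0, (sum_quatWord_eq_of_commute hz (fun i ↦ ι (c i)) (fun i ↦ ha _) (fun i ↦ hb _)
      (hx a (Algebra.subset_adjoin (by simp))).symm
      (hx b (Algebra.subset_adjoin (by simp))).symm).symm⟩
  · intro x hx y hy
    rw [← hcent] at hy
    exact (hy x hx).symm

lemma map_center_adjoin_eq {S : Subalgebra F B} {ι : T →ₐ[F] B} (hle : ι.range ≤ S)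
    (hcent : Subalgebra.centralizer F (S : Set B) = ι.range) :
    (Subalgebra.center F S).map S.val = ι.range := by
  apply le_antisymm
  · rintro _ ⟨x, hx, rfl⟩
    rw [← hcent]
    exact fun y hy ↦ congrArg Subtype.val (Subalgebra.mem_center_iff.mp hx ⟨y, hy⟩)
  · intro x hx
    refine ⟨⟨x, hle hx⟩, Subalgebra.mem_center_iff.mpr fun y ↦ Subtype.ext ?_, rfl⟩
    rw [← hcent] at hx
    exact hx y y.2

lemma free_adjoin_of_quatSum [Nontrivial T] {ι : T →ₐ[F] B} {a b : B} {S : Subalgebra F B}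
    (hinj : Function.Injective (quatSum ι a b))
    (hrange : LinearMap.range (quatSum ι a b) = S.toSubmodule)
    (f : T →+* S) (hf : ∀ x, (f x : B) = ι x) :
    letI : Module T S := Module.compHom S f
    Module.Free T S ∧ Module.finrank T S = 4 := by
  let : Module T S := Module.compHom S f
  have hmem (c : Fin 4 → T) : quatSum ι a b c ∈ S := by
    rw [← Subalgebra.mem_toSubmodule, ← hrange]
    exact ⟨c, rfl⟩
  let g : (Fin 4 → T) →ₗ[T] S :=
    { toFun := fun c ↦ ⟨quatSum ι a b c, hmem c⟩
      map_add' := fun c d ↦ Subtype.ext (map_add _ c d)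
      map_smul' := fun r c ↦ Subtype.ext (by
        change quatSum ι a b (r • c) = (f r : B) * quatSum ι a b c
        simp [quatSum_apply, hf, Finset.mul_sum, mul_assoc]) }
  have hg : Function.Bijective g := by
    refine ⟨fun c d h ↦ hinj (congrArg Subtype.val h), fun x ↦ ?_⟩
    have hx : (x : B) ∈ S.toSubmodule := x.2
    rw [← hrange] at hx
    obtain ⟨c, hc⟩ := hx
    exact ⟨c, Subtype.ext hc⟩
  let e := LinearEquiv.ofBijective g hg
  exact ⟨Module.Free.of_equiv e, by rw [← e.finrank_eq, Module.finrank_fin_fun]⟩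

lemma free_of_biSum_surjective [FiniteDimensional F B] [FiniteDimensional F T]
    (hdim : Module.finrank F B = 4 * Module.finrank F T ^ 2) {ι : T →ₐ[F] B} {a b u : B}
    {S : Subalgebra F B} (hle : ι.range ≤ S) (ha : a ∈ S) (hb : b ∈ S)
    (hS : Module.finrank F S = 4 * Module.finrank F T)
    (hu : Function.Surjective (biSum ι a b u)) :
    letI : Module S B := Module.compHom B S.val.toRingHom
    Module.Free S B := by
  let ℓ := Module.finBasis F T
  let : Module S B := Module.compHom B S.val.toRingHom
  let g : (Fin (Module.finrank F T) → S) →ₗ[S] B :=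
    { toFun := fun c ↦ ∑ k, (c k : B) * (u * ι (ℓ k))
      map_add' := fun c d ↦ by simp [add_mul, Finset.sum_add_distrib]
      map_smul' := fun r c ↦ by
        change _ = (r : B) * _
        simp [Finset.mul_sum, mul_assoc] }
  let g' : (Fin (Module.finrank F T) → S) →ₗ[F] B :=
    { toFun := g
      map_add' := map_add g
      map_smul' := fun r c ↦ by
        change ∑ k, ((r • c k : S) : B) * (u * ι (ℓ k)) = r • ∑ k, (c k : B) * (u * ι (ℓ k))
        simp [Finset.smul_sum] }
  have hword (i : Fin 4) : quatWord a b i ∈ S := by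
    fin_cases i
    exacts [one_mem _, ha, hb, mul_mem ha hb]
  have hact (i : Fin 4) (r : T ⊗[F] T) :
      biAction ι r (quatWord a b i * u) ∈ LinearMap.range g' := by
    induction r using TensorProduct.induction_on with
    | zero => simp
    | tmul x y =>
      refine ⟨fun k ↦ ℓ.repr y k • ⟨ι x * quatWord a b i, mul_mem (hle ⟨x, rfl⟩) (hword i)⟩, ?_⟩
      change ∑ k, ((ℓ.repr y k • (ι x * quatWord a b i) : B)) * (u * ι (ℓ k)) = _
      conv_rhs => rw [biAction_tmul, ← ℓ.sum_repr y, map_sum, Finset.mul_sum]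
      refine Finset.sum_congr rfl fun k _ ↦ ?_
      rw [map_smul, mul_smul_comm, smul_mul_assoc]
      simp only [mul_assoc]
    | add r s hr hs =>
      rw [map_add, LinearMap.add_apply]
      exact add_mem hr hs
  have hsurj : Function.Surjective g' := by
    intro v
    obtain ⟨c, rfl⟩ := hu v
    rw [biSum_apply]
    exact sum_mem fun i _ ↦ hact i (c i)
  have hinj : Function.Injective g' := by
    refine (LinearMap.injective_iff_surjective_of_finrank_eq_finrank ?_).mpr hsurj
    rw [hdim, Module.finrank_pi_fintype, Finset.sum_const, Finset.card_univ, Fintype.card_fin, hS,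
      smul_eq_mul]
    ring
  exact Module.Free.of_equiv (LinearEquiv.ofBijective g ⟨hinj, hsurj⟩)

end BiAction

lemma exists_trace_norm {F K : Type*} [Field F] [CommRing K] [Algebra F K] (σ : K ≃ₐ[F] K)
    (hσ : ∀ x, σ (σ x) = x) (hfix : ∀ x : K, σ x = x ↔ ∃ a : F, algebraMap F K a = x) (x : K) :
    ∃ t n : F, algebraMap F K t = x + σ x ∧ algebraMap F K n = x * σ x := by
  obtain ⟨t, ht⟩ := (hfix (x + σ x)).mp (by rw [map_add, hσ, add_comm])
  obtain ⟨n, hn⟩ := (hfix (x * σ x)).mp (by rw [map_mul, hσ, mul_comm])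
  exact ⟨t, n, ht, hn⟩

lemma adjoin_range_union_range_eq {F K₁ K₂ B : Type*} [CommRing F] [CommRing K₁] [CommRing K₂]
    [Ring B] [Algebra F K₁] [Algebra F K₂] [Algebra F B] (Φ₁ : K₁ →ₐ[F] B) (Φ₂ : K₂ →ₐ[F] B)
    {x₁ : K₁} (hx₁ : ∀ k : K₁, ∃ a b : F, k = algebraMap F K₁ a + algebraMap F K₁ b * x₁)
    {x₂ : K₂} (hx₂ : ∀ k : K₂, ∃ a b : F, k = algebraMap F K₂ a + algebraMap F K₂ b * x₂) :
    Algebra.adjoin F (Set.range ⇑Φ₁ ∪ Set.range ⇑Φ₂) = Algebra.adjoin F {Φ₁ x₁, Φ₂ x₂} := by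
  have hmem (c d : F) {x : B} (hx : x ∈ Algebra.adjoin F {Φ₁ x₁, Φ₂ x₂}) :
      algebraMap F B c + algebraMap F B d * x ∈ Algebra.adjoin F {Φ₁ x₁, Φ₂ x₂} :=
    add_mem (Subalgebra.algebraMap_mem _ c) (mul_mem (Subalgebra.algebraMap_mem _ d) hx)
  apply le_antisymm
  · refine Algebra.adjoin_le ?_
    rintro _ (⟨k, rfl⟩ | ⟨k, rfl⟩)
    · obtain ⟨c, d, rfl⟩ := hx₁ k
      simpa using hmem c d (Algebra.subset_adjoin (by simp))
    · obtain ⟨c, d, rfl⟩ := hx₂ k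
      simpa using hmem c d (Algebra.subset_adjoin (by simp))
  · refine Algebra.adjoin_mono ?_
    rintro _ (rfl | rfl)
    exacts [Or.inl ⟨x₁, rfl⟩, Or.inr ⟨x₂, rfl⟩]

/-- Structure of the algebras `A = F(Φ₁,Φ₂)` and `L = F[w]` attached to a
regular semisimple pair `(Φ₁, Φ₂)`. -/
theorem regular_semisimple_pair_structure
    (F : Type u) [Field F] (K₁ K₂ : Type u)
    [CommRing K₁] [CommRing K₂] [Algebra F K₁] [Algebra F K₂]
    [Algebra.Etale F K₁] [Algebra.Etale F K₂]
    (hdim₁ : Module.finrank F K₁ = 2) (hdim₂ : Module.finrank F K₂ = 2)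
    (σ₁ : K₁ ≃ₐ[F] K₁) (σ₂ : K₂ ≃ₐ[F] K₂)
    (hσ₁ : ∀ x : K₁, σ₁ (σ₁ x) = x) (hσ₂ : ∀ x : K₂, σ₂ (σ₂ x) = x)
    (hσ₁fix : ∀ x : K₁, σ₁ x = x ↔ ∃ a : F, algebraMap F K₁ a = x)
    (hσ₂fix : ∀ x : K₂, σ₂ x = x ↔ ∃ a : F, algebraMap F K₂ a = x)
    (h : ℕ) (hh : 0 < h)
    (B : Type u) [Ring B] [Algebra F B] [FiniteDimensional F B]
    [Algebra.IsCentral F B] [IsSimpleRing B]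
    (hB : Module.finrank F B = 4 * h ^ 2)
    (Φ₁ : K₁ →ₐ[F] B) (Φ₂ : K₂ →ₐ[F] B)
    -- `Φ̃₁, Φ̃₂ : K → C = B ⊗[F] K₃`, the unique `K₃`-algebra extensions of `Φ₁, Φ₂`
    (Φt₁ Φt₂ : (K₁ ⊗[F] K₂) →ₐ[F] B ⊗[F] (K3 σ₁ σ₂))
    (hΦt₁ : ∀ x : K₁, Φt₁ (x ⊗ₜ[F] (1 : K₂)) = Φ₁ x ⊗ₜ[F] (1 : K3 σ₁ σ₂))
    (hΦt₂ : ∀ x : K₂, Φt₂ ((1 : K₁) ⊗ₜ[F] x) = Φ₂ x ⊗ₜ[F] (1 : K3 σ₁ σ₂))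
    (hΦt₁c : ∀ c : K3 σ₁ σ₂, Φt₁ (c : K₁ ⊗[F] K₂) = (1 : B) ⊗ₜ[F] c)
    (hΦt₂c : ∀ c : K3 σ₁ σ₂, Φt₂ (c : K₁ ⊗[F] K₂) = (1 : B) ⊗ₜ[F] c)
    -- a `K₃`-generator `y` of `K`
    (y : K₁ ⊗[F] K₂)
    (hygen : ∀ k : K₁ ⊗[F] K₂, ∃ a b : K3 σ₁ σ₂, k = (a : K₁ ⊗[F] K₂) + (b : K₁ ⊗[F] K₂) * y)
    (hyunit : IsUnit (y - tau3 σ₁ σ₂ y))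
    -- the pair `(Φ₁, Φ₂)` is regular semisimple
    (s : B ⊗[F] (K3 σ₁ σ₂))
    (hs : s = Ring.inverse (Φt₁ ((y - tau3 σ₁ σ₂ y) ^ 2)) * (Φt₁ y - Φt₂ (tau3 σ₁ σ₂ y)) ^ 2)
    (hsunit : IsUnit s)
    (hetale : Algebra.Etale (K3 σ₁ σ₂) (Algebra.adjoin (K3 σ₁ σ₂) {s}))
    (hfree : Module.Free (K3 σ₁ σ₂) (Algebra.adjoin (K3 σ₁ σ₂) {s}))
    (hrank : Module.finrank (K3 σ₁ σ₂) (Algebra.adjoin (K3 σ₁ σ₂) {s}) = h)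
    -- `F`-algebra generators `x₁` of `K₁` and `x₂` of `K₂`
    (x₁ : K₁) (hx₁ : ∀ k : K₁, ∃ a b : F, k = algebraMap F K₁ a + algebraMap F K₁ b * x₁)
    (x₂ : K₂) (hx₂ : ∀ k : K₂, ∃ a b : F, k = algebraMap F K₂ a + algebraMap F K₂ b * x₂) :
    let w : B := Φ₁ x₁ * Φ₂ x₂ + Φ₂ (σ₂ x₂) * Φ₁ (σ₁ x₁)
    let z : B := Φ₁ x₁ * Φ₂ x₂ - Φ₂ x₂ * Φ₁ x₁
    let A : Subalgebra F B := Algebra.adjoin F (Set.range ⇑Φ₁ ∪ Set.range ⇑Φ₂)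
    let L : Subalgebra F B := Algebra.adjoin F {w}
    -- (1)
    IsUnit z ∧
    -- (2)
    (Algebra.Etale F L ∧ Module.finrank F L = h) ∧
    -- (3)
    Subalgebra.centralizer F (A : Set B) = L ∧
    -- (4)
    Subalgebra.centralizer F (L : Set B) = A ∧
    -- (5)
    ((Subalgebra.center F A).map A.val = L ∧
      ∃ hLA : L ≤ A,
        letI : Module L A := Module.compHom A (Subalgebra.inclusion hLA).toRingHom;
        Module.Free L A ∧ Module.finrank L A = 4) ∧
    -- (6)
    (letI : Module A B := Module.compHom B A.val.toRingHom;
      Module.Free A B) := by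
  intro w z A L
  obtain ⟨t₁, n₁, ht₁, hn₁⟩ := exists_trace_norm σ₁ hσ₁ hσ₁fix x₁
  obtain ⟨t₂, n₂, ht₂, hn₂⟩ := exists_trace_norm σ₂ hσ₂ hσ₂fix x₂
  have haa := mul_self_image Φ₁ ht₁ hn₁
  have hbb := mul_self_image Φ₂ ht₂ hn₂
  have hw : w = _ := pair_trace_eq Φ₁ Φ₂ ht₁ ht₂
  have : Nontrivial (K₁ ⊗[F] K₂) := Module.nontrivial_of_finrank_pos (R := F) (by
    rw [Module.finrank_tensorProduct, hdim₁, hdim₂]; norm_num)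
  have : Nontrivial (K3 σ₁ σ₂) := (K3 σ₁ σ₂).toSubring.nontrivial
  obtain ⟨κ, hκ⟩ := exists_invariant_eq hσ₁ hσ₂ (isUnit_sub_conj hdim₁ σ₁ hσ₁ hσ₁fix hx₁)
    (isUnit_sub_conj hdim₂ σ₂ hσ₂ hσ₂fix hx₂) ht₁ hn₁ ht₂ hn₂ hΦt₁ hΦt₂ hΦt₁c hΦt₂c hyunit
  rw [← hs] at hκ
  have hz : IsUnit z := isUnit_commutator_of_isUnit hσ₁ hσ₂ ht₁ hn₁ ht₂ hn₂ Φ₁ Φ₂ (by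
    rw [hκ] at hsunit
    exact (isUnit_smul_iff κ _).mp hsunit)
  obtain ⟨hLet, hLdim⟩ := etale_adjoin_of_baseChange w hκ hetale
  rw [hrank] at hLdim
  let T := Algebra.adjoin F {w}
  let ι : T →ₐ[F] B := T.val
  have hι : Function.Injective ι := Subtype.val_injective
  have hιrange : ι.range = L := T.range_val
  have hcomm {x : B} (hx : Commute w x) (y : T) : Commute (ι y) x := by
    have h : T ≤ Subalgebra.centralizer F {x} := Algebra.adjoin_le
      (Set.singleton_subset_iff.mpr fun _ hy ↦ (Set.mem_singleton_iff.mp hy) ▸ hx.symm)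
    exact (h y.2 x rfl).symm
  have ha := hcomm (hw ▸ commute_left_of_quaternion_relations haa)
  have hb := hcomm (hw ▸ commute_right_of_quaternion_relations hbb)
  have hwT : w ∈ T := Algebra.self_mem_adjoin_singleton F w
  have ht : Algebra.adjoin F {(⟨w, hwT⟩ : T)} = ⊤ := by
    rw [← Algebra.adjoin_adjoin_coe_preimage (R := F) (s := {w})]
    congr 1
    ext y
    exact Subtype.ext_iff
  have hba : Φ₂ x₂ * Φ₁ x₁ = ι (⟨w, hwT⟩ - algebraMap F T (t₁ * t₂)) + t₂ • Φ₁ x₁ + t₁ • Φ₂ x₂ -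
      Φ₁ x₁ * Φ₂ x₂ := by
    rw [map_sub, AlgHom.commutes]
    change _ = w - _ + _ + _ - _
    rw [hw, Algebra.algebraMap_eq_smul_one]
    abel
  have hA : A = Algebra.adjoin F {Φ₁ x₁, Φ₂ x₂} := adjoin_range_union_range_eq Φ₁ Φ₂ hx₁ hx₂
  have haA : Φ₁ x₁ ∈ A := Algebra.subset_adjoin (Or.inl ⟨x₁, rfl⟩)
  have hbA : Φ₂ x₂ ∈ A := Algebra.subset_adjoin (Or.inr ⟨x₂, rfl⟩)
  have hLA : L ≤ A := by
    refine Algebra.adjoin_le (Set.singleton_subset_iff.mpr ?_)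
    exact add_mem (mul_mem haA hbA) (mul_mem (Algebra.subset_adjoin (Or.inr ⟨σ₂ x₂, rfl⟩))
      (Algebra.subset_adjoin (Or.inl ⟨σ₁ x₁, rfl⟩)))
  have hle : ι.range ≤ A := hιrange.trans_le hLA
  have hfin : Module.finrank F B = 4 * Module.finrank F T ^ 2 := by rw [hB, hLdim]
  obtain ⟨u, hu⟩ := exists_biSum_bijective hfin hι ha hb haa hbb hba hz
  have hrange := range_quatSum ha hb haa hbb hba (hA ▸ hle)
  have hCL := centralizer_range_eq hι ht ha hb hz hrange hu
  have hCA := centralizer_adjoin_eq ha hb hz (hA ▸ hle) hrange hCL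
  have hinj := quatSum_injective hι ha hb hz
  rw [← hA] at hrange hCL hCA
  have : Nontrivial T := Module.nontrivial_of_finrank_pos (R := F) (by rw [hLdim]; exact hh)
  have hSdim : Module.finrank F A = 4 * Module.finrank F T := by
    rw [← Subalgebra.finrank_toSubmodule, ← hrange, LinearMap.finrank_range_of_inj hinj]
    simp [Module.finrank_pi_fintype]
  refine ⟨hz, ⟨hLet, hLdim⟩, hCA.trans hιrange, ?_, ⟨?_, hLA, ?_⟩, ?_⟩
  · rw [← hιrange]
    exact hCL
  · exact (map_center_adjoin_eq hle hCA).trans hιrange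
  · exact free_adjoin_of_quatSum hinj hrange (Subalgebra.inclusion hLA).toRingHom fun x ↦ rfl
  · exact free_of_biSum_surjective hfin hle haA hbA hSdim hu.2
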